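/- arXiv:1907.01241 — 6 statements merged into one kernel-verified Lean document; each statement's English description precedes it below -/
import Mathlib

section
/- For every natural number n, there exists a family of n (possibly intersecting) convex sets in the plane ℝ² that is shattered by halfplanes. Consequently, the VC-dimension of halfplanes with respect to convex sets in the plane is unbounded. -/
open RealInnerProductSpace

/-- The Euclidean plane `ℝ²`. -/
abbrev Plane : Type := EuclideanSpace ℝ (Fin 2)

/-- A (closed) halfplane: `{x | ⟪a, x⟫ ≤ b}` for some nonzero `a` and real `b`. -/
def IsHalfplane (h : Set Plane) : Prop :=
  ∃ a : Plane, a ≠ 0 ∧ ∃ b : ℝ, h = {x : Plane | ⟪a, x⟫ ≤ b}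

/-- A family of sets in the plane is shattered by halfplanes if every subfamily is
realized by some halfplane. -/
def ShatteredByHalfplanes {ι : Type} (C : ι → Set Plane) : Prop :=
  ∀ T : Set ι, ∃ h : Set Plane, IsHalfplane h ∧ ∀ i : ι, C i ⊆ h ↔ i ∈ T

theorem IsHalfplane.convex {h : Set Plane} (hh : IsHalfplane h) : Convex ℝ h := by
  obtain ⟨a, -, b, rfl⟩ := hh
  exact convex_halfSpace_le (innerₛₗ ℝ a).isLinear b

/-- The point with abscissa `k` on the standard parabola. -/
noncomputable def parabolaPoint (k : ℕ) : Plane := !₂[(k : ℝ), (k : ℝ) ^ 2]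

/-- A halfplane cutting off `parabolaPoint k` from all the other points `parabolaPoint m`. -/
def parabolaHalfplane (k : ℕ) : Set Plane :=
  {x : Plane | ⟪(!₂[2 * (k : ℝ), -1] : Plane), x⟫ ≤ (k : ℝ) ^ 2 - 1}

theorem isHalfplane_parabolaHalfplane (k : ℕ) : IsHalfplane (parabolaHalfplane k) :=
  ⟨_, fun h => by simpa using congrArg (fun x : Plane => x 1) h, _, rfl⟩

theorem parabolaPoint_mem_parabolaHalfplane {m k : ℕ} :
    parabolaPoint m ∈ parabolaHalfplane k ↔ m ≠ k := by
  have key : parabolaPoint m ∈ parabolaHalfplane k ↔ (1 : ℤ) ≤ ((m : ℤ) - k) ^ 2 := by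
    simp only [parabolaPoint, parabolaHalfplane, Set.mem_ofPred_eq, PiLp.inner_apply,
      Fin.sum_univ_two]
    rw [← Int.cast_le (R := ℝ)]
    push_cast
    simp only [RCLike.inner_apply, conj_trivial]
    constructor <;> intro h <;> linarith
  rw [key, show (1 : ℤ) ≤ ((m : ℤ) - k) ^ 2 ↔ 0 < ((m : ℤ) - k) ^ 2 from Iff.rfl,
    sq_pos_iff, sub_ne_zero, ne_eq, Nat.cast_inj]

/-- For every `n`, there is a family of `n` (possibly intersecting) convex sets in the
plane that is shattered by halfplanes. -/
theorem unbounded_VC_convex_sets_plane (n : ℕ) :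
    ∃ C : Fin n → Set Plane,
      (∀ i, Convex ℝ (C i)) ∧ ShatteredByHalfplanes C := by
  obtain ⟨e, he⟩ := exists_injective_nat (Set (Fin n))
  -- `C i` is spanned by the points of the parabola that encode the sets avoiding `i`.
  refine ⟨fun i => convexHull ℝ ((fun S : Set (Fin n) => parabolaPoint (e S)) '' {S | i ∉ S}),
    fun i => convex_convexHull ℝ _, fun T => ⟨_, isHalfplane_parabolaHalfplane (e T), fun i => ?_⟩⟩
  rw [(isHalfplane_parabolaHalfplane (e T)).convex.convexHull_subset_iff, Set.image_subset_iff]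
  simp only [Set.subset_def, Set.mem_preimage, Set.mem_ofPred_eq,
    parabolaPoint_mem_parabolaHalfplane, he.ne_iff]
  exact ⟨fun h => by_contra fun hi => h T hi rfl, fun hi S hS hST => hS (hST ▸ hi)⟩
end

section
/- No family of four nonempty pairwise disjoint convex sets in the plane ℝ² is shattered by halfplanes. Equivalently, the VC-dimension of halfplanes with respect to pairwise disjoint convex sets in the plane is at most 3. -/
open RealInnerProductSpace

namespace HalfplaneShattering

section Combinatorics

variable {ι α : Type*} [LinearOrder α]

/-- `T` consists of the elements of smallest rank with respect to `r`. -/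
def IsPrefix (r : ι → α) (T : Finset ι) : Prop :=
  ∀ i ∈ T, ∀ j ∉ T, r i < r j

/-- The two rankings `r` and `s` order `i` and `j` as `i < j` and `j < i` respectively. -/
def Swaps (r s : ι → α) (i j : ι) : Prop :=
  r i < r j ∧ s j < s i

lemma IsPrefix.subset_or_subset {r : ι → α} {T U : Finset ι} (hT : IsPrefix r T)
    (hU : IsPrefix r U) : T ⊆ U ∨ U ⊆ T := by
  by_contra! h
  obtain ⟨i, hiT, hiU⟩ := Finset.not_subset.1 h.1
  obtain ⟨j, hjU, hjT⟩ := Finset.not_subset.1 h.2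
  exact lt_asymm (hT i hiT j hjT) (hU j hjU i hiU)

/-- The pair `(i, j)` witnesses in a canonical way that `T` is a prefix for `r` but not for `s`:
`i` has the largest `s`-rank in `T`, and `j` is the element of smallest `r`-rank among those outside
`T` which precede `i` for `s`. -/
def IsExitPair (r s : ι → α) (T : Finset ι) (i j : ι) : Prop :=
  i ∈ T ∧ j ∉ T ∧ s j < s i ∧ (∀ e ∈ T, s e ≤ s i) ∧ ∀ e ∉ T, s e < s i → r j ≤ r e

lemma exists_isExitPair [Fintype ι] {r s : ι → α} (hs : Function.Injective s) {T : Finset ι}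
    (h : ¬ IsPrefix s T) : ∃ i j, IsExitPair r s T i j := by
  classical
  simp only [IsPrefix, not_forall, not_lt] at h
  obtain ⟨i₀, hi₀, j₀, hj₀, hle⟩ := h
  have hlt : s j₀ < s i₀ := lt_of_le_of_ne hle fun h => hj₀ (hs h ▸ hi₀)
  obtain ⟨i, hi, himax⟩ := T.exists_max_image s ⟨i₀, hi₀⟩
  obtain ⟨j, hj, hjmin⟩ := (Finset.univ.filter fun e => e ∉ T ∧ s e < s i).exists_min_image r
    ⟨j₀, by simpa using ⟨hj₀, hlt.trans_le (himax _ hi₀)⟩⟩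
  simp only [Finset.mem_filter, Finset.mem_univ, true_and] at hj hjmin
  exact ⟨i, j, hi, hj.1, hj.2, himax, fun e he hei => hjmin e ⟨he, hei⟩⟩

lemma IsExitPair.subset {r s : ι → α} (hs : Function.Injective s) {T U : Finset ι} {i j : ι}
    (hU : IsPrefix r U) (hTij : IsExitPair r s T i j) (hUij : IsExitPair r s U i j) : U ⊆ T := by
  intro e he
  by_contra heT
  have hne : s e ≠ s i := fun h => heT (hs h ▸ hTij.1)
  exact (hTij.2.2.2.2 e heT (lt_of_le_of_ne (hUij.2.2.2.1 e he) hne)).not_gt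
    (hU e he j hUij.2.1)

lemma exists_and_not_add_one {m : ℕ} [NeZero m] {P : Fin m → Prop} {k l : Fin m} (hk : P k)
    (hl : ¬ P l) : ∃ n, P n ∧ ¬ P (n + 1) := by
  by_contra! h
  have key : ∀ n : ℕ, P (k + Fin.ofNat m n) := by
    intro n
    induction n with
    | zero => simpa using hk
    | succ n ih =>
      have := h _ ih
      rwa [add_assoc, show Fin.ofNat m n + 1 = Fin.ofNat m (n + 1) by
        ext; simp [Fin.val_add]] at this
  apply hl
  have := key (l - k).val
  rwa [Fin.ofNat_val_eq_self, add_sub_cancel] at this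

/-- If a cyclic sequence of rankings has every set as a prefix of some ranking, and every ordered
pair is swapped at most once, then there are at least as many ordered pairs of distinct elements
as nontrivial sets. -/
lemma card_nontrivial_finset_le [Fintype ι] [DecidableEq ι] {m : ℕ} [NeZero m]
    (r : Fin m → ι → α) (hinj : ∀ k, Function.Injective (r k))
    (hprefix : ∀ T, ∃ k, IsPrefix (r k) T)
    (hswap : ∀ i j k l, Swaps (r k) (r (k + 1)) i j → Swaps (r l) (r (l + 1)) i j → k = l) :
    Fintype.card {T : Finset ι // T.Nonempty ∧ T ≠ Finset.univ} ≤
      Fintype.card {p : ι × ι // p.1 ≠ p.2} := by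
  have hexit : ∀ T : {T : Finset ι // T.Nonempty ∧ T ≠ Finset.univ}, ∃ k i j,
      IsPrefix (r k) T.1 ∧ IsExitPair (r k) (r (k + 1)) T.1 i j := by
    rintro ⟨T, ⟨a, ha⟩, hT⟩
    obtain ⟨b, hb⟩ : ∃ b, b ∉ T := by simpa [Finset.eq_univ_iff_forall] using hT
    obtain ⟨k₀, hk₀⟩ := hprefix T
    obtain ⟨l₀, hl₀⟩ := hprefix Tᶜ
    have hl₀' : ¬ IsPrefix (r l₀) T := fun h =>
      lt_asymm (h a ha b hb) (hl₀ b (by simpa using hb) a (by simpa using ha))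
    obtain ⟨k, hk, hk'⟩ := exists_and_not_add_one (P := fun k => IsPrefix (r k) T) hk₀ hl₀'
    obtain ⟨i, j, hij⟩ := exists_isExitPair (r := r k) (hinj (k + 1)) hk'
    exact ⟨k, i, j, hk, hij⟩
  choose k i j hk hij using hexit
  refine Fintype.card_le_of_injective
    (fun T => ⟨(i T, j T), fun h => (hij T).2.1 (Eq.subst (motive := (· ∈ T.1)) h (hij T).1)⟩) ?_
  intro T U hTU
  simp only [Subtype.mk.injEq, Prod.mk.injEq] at hTU
  have hsw : ∀ V, Swaps (r (k V)) (r (k V + 1)) (i V) (j V) := fun V =>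
    ⟨hk V _ (hij V).1 _ (hij V).2.1, (hij V).2.2.1⟩
  have hkk : k T = k U := hswap (i T) (j T) _ _ (hsw T) (by simpa only [hTU] using hsw U)
  have hU := hij U
  have hkU := hk U
  rw [← hkk] at hU hkU
  rw [← hTU.1, ← hTU.2] at hU
  exact Subtype.ext (subset_antisymm (hU.subset (hinj _) (hk T) (hij T))
    ((hij T).subset (hinj _) hkU hU))

end Combinatorics

section CyclicSequences

open Real

/-- A set of angles meeting some period in an interval has no alternating quadruple. -/
lemma no_alternation {F : ℝ → Prop} (hF : ∀ θ, F (θ + 2 * π) ↔ F θ) {φ : ℝ}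
    (hφ : φ ∈ Set.Ioc (-π) π)
    (hconn : ∀ x y z, φ ≤ x → x ≤ y → y ≤ z → z ≤ φ + 2 * π → F x → F z → F y)
    {a b c d : ℝ} (ha : -π < a) (hab : a < b) (hbc : b < c) (hcd : c < d) (hd : d ≤ π) :
    ¬ (F a ∧ ¬ F b ∧ F c ∧ ¬ F d) ∧ ¬ (¬ F a ∧ F b ∧ ¬ F c ∧ F d) := by
  obtain ⟨h1, h2⟩ := hφ
  constructor
  · rintro ⟨Fa, Fb, Fc, Fd⟩
    rcases le_or_gt φ a with h | h
    · exact Fb (hconn a b c h hab.le hbc.le (by linarith) Fa Fc)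
    rcases le_or_gt φ c with h' | h'
    · exact Fd (hconn c d (a + 2 * π) h' hcd.le (by linarith) (by linarith) Fc ((hF a).2 Fa))
    · exact Fb ((hF b).1 (hconn (a + 2 * π) (b + 2 * π) (c + 2 * π) (by linarith) (by linarith)
        (by linarith) (by linarith) ((hF a).2 Fa) ((hF c).2 Fc)))
  · rintro ⟨Fa, Fb, Fc, Fd⟩
    rcases le_or_gt φ b with h | h
    · exact Fc (hconn b c d h hbc.le hcd.le (by linarith) Fb Fd)
    rcases le_or_gt φ d with h' | h'
    · exact Fa ((hF a).1 (hconn d (a + 2 * π) (b + 2 * π) h' (by linarith) (by linarith)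
        (by linarith) Fd ((hF b).2 Fb)))
    · exact Fc ((hF c).1 (hconn (b + 2 * π) (c + 2 * π) (d + 2 * π) (by linarith) (by linarith)
        (by linarith) (by linarith) ((hF b).2 Fb) ((hF d).2 Fd)))

lemma descent_unique {m : ℕ} [NeZero m] {P : Fin m → Prop}
    (hP : ∀ a b c d, a < b → b < c → c < d →
      ¬ (P a ∧ ¬ P b ∧ P c ∧ ¬ P d) ∧ ¬ (¬ P a ∧ P b ∧ ¬ P c ∧ P d))
    {k l : Fin m} (hk : P k ∧ ¬ P (k + 1)) (hl : P l ∧ ¬ P (l + 1)) : k = l := by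
  wlog hkl : k < l generalizing k l
  · rcases (not_lt.1 hkl).eq_or_lt with h | h
    · exact h.symm
    · exact (this hl hk h).symm
  obtain ⟨n, rfl⟩ := Nat.exists_eq_succ_of_ne_zero (NeZero.ne m)
  have hk1 : k < k + 1 := Fin.lt_add_one_iff.2 (hkl.trans_le (Fin.le_last l))
  have hk1l : k + 1 < l := by
    refine lt_of_le_of_ne (Fin.add_one_le_of_lt hkl) ?_
    rintro h
    exact hk.2 (h ▸ hl.1)
  rcases (Fin.le_last l).eq_or_lt with h | h
  · have h0 : ¬ P 0 := by simpa [h] using hl.2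
    have hk0 : 0 < k := Fin.pos_iff_ne_zero.2 fun h => h0 (h ▸ hk.1)
    exact absurd ⟨h0, hk.1, hk.2, hl.1⟩ (hP 0 k (k + 1) l hk0 hk1 hk1l).2
  · exact absurd ⟨hk.1, hk.2, hl.1, hl.2⟩
      (hP k (k + 1) l (l + 1) hk1 hk1l (Fin.lt_add_one_iff.2 h)).1

end CyclicSequences

section Plane

open Real

/-- The unit vector at angle `θ`. -/
noncomputable def unitVec (θ : ℝ) : Plane := !₂[cos θ, sin θ]

lemma unitVec_add_two_pi (θ : ℝ) : unitVec (θ + 2 * π) = unitVec θ := by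
  simp [unitVec]

lemma unitVec_add_pi (θ : ℝ) : unitVec (θ + π) = -unitVec θ := by
  ext i; fin_cases i <;> simp [unitVec]

lemma exists_eq_smul_unitVec {a : Plane} (ha : a ≠ 0) :
    ∃ θ ∈ Set.Ioc (-π) π, ∃ ρ : ℝ, 0 < ρ ∧ a = ρ • unitVec θ := by
  let z : ℂ := ⟨a 0, a 1⟩
  have hz : z ≠ 0 := by
    intro h
    apply ha
    ext i
    fin_cases i
    · exact congrArg Complex.re h
    · exact congrArg Complex.im h
  refine ⟨z.arg, Complex.arg_mem_Ioc z, ‖z‖, norm_pos_iff.2 hz, ?_⟩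
  ext i
  fin_cases i
  · exact (Complex.norm_mul_cos_arg z).symm
  · exact (Complex.norm_mul_sin_arg z).symm

lemma sin_smul_unitVec (x y z : ℝ) :
    sin (z - x) • unitVec y = sin (z - y) • unitVec x + sin (y - x) • unitVec z := by
  ext i
  fin_cases i <;> simp [unitVec, sin_sub] <;> ring

variable {κ : Type*} [Finite κ] [Nonempty κ]

/-- The support function of the set of points `p k`. -/
noncomputable def supportFun (p : κ → Plane) (u : Plane) : ℝ := ⨆ k, ⟪u, p k⟫

omit [Nonempty κ] in
lemma inner_le_supportFun (p : κ → Plane) (u : Plane) (k : κ) : ⟪u, p k⟫ ≤ supportFun p u :=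
  le_ciSup (f := fun k => ⟪u, p k⟫) (Set.finite_range _).bddAbove k

lemma exists_inner_eq_supportFun (p : κ → Plane) (u : Plane) : ∃ k, ⟪u, p k⟫ = supportFun p u :=
  exists_eq_ciSup_of_finite

lemma supportFun_le_of_smul_eq {p q : κ → Plane} {z u v : Plane}
    (hz : ∀ k l, ⟪z, p k⟫ < ⟪z, q l⟫) {α β γ : ℝ} (hα : 0 ≤ α) (hβ : 0 ≤ β) (hγ : 0 < γ)
    (h : γ • v = α • u + β • z) (hu : supportFun p u ≤ supportFun q u) :
    supportFun p v ≤ supportFun q v := by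
  obtain ⟨k, hk⟩ := exists_inner_eq_supportFun p v
  obtain ⟨l, hl⟩ := exists_inner_eq_supportFun q u
  have key : ∀ x : Plane, γ * ⟪v, x⟫ = α * ⟪u, x⟫ + β * ⟪z, x⟫ := fun x => by
    simpa [inner_add_left, real_inner_smul_left] using congrArg (fun y => ⟪y, x⟫) h
  have h1 : α * ⟪u, p k⟫ ≤ α * ⟪u, q l⟫ :=
    mul_le_mul_of_nonneg_left (((inner_le_supportFun p u k).trans hu).trans hl.ge) hα
  have h2 : β * ⟪z, p k⟫ ≤ β * ⟪z, q l⟫ := mul_le_mul_of_nonneg_left (hz k l).le hβ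
  have h3 : γ * ⟪v, p k⟫ ≤ γ * ⟪v, q l⟫ := by rw [key, key]; exact add_le_add h1 h2
  rw [← hk]
  exact (le_of_mul_le_mul_left h3 hγ).trans (inner_le_supportFun q v l)

/-- For two finite sets of points with disjoint convex hulls, the directions in which the first
reaches at most as far as the second form an arc. -/
lemma exists_supportFun_le_connected {p q : κ → Plane}
    (hdisj : Disjoint (convexHull ℝ (Set.range p)) (convexHull ℝ (Set.range q))) :
    ∃ φ ∈ Set.Ioc (-π) π, ∀ x y z, φ ≤ x → x ≤ y → y ≤ z → z ≤ φ + 2 * π →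
      supportFun p (unitVec x) ≤ supportFun q (unitVec x) →
      supportFun p (unitVec z) ≤ supportFun q (unitVec z) →
      supportFun p (unitVec y) ≤ supportFun q (unitVec y) := by
  obtain ⟨f, s, t, hs, hst, ht⟩ := geometric_hahn_banach_compact_closed (convex_convexHull ℝ _)
    ((Set.finite_range p).isCompact_convexHull ℝ) (convex_convexHull ℝ _)
    ((Set.finite_range q).isClosed_convexHull ℝ) hdisj
  let a : Plane := (InnerProductSpace.toDual ℝ Plane).symm f
  have ha : ∀ k l, ⟪a, p k⟫ < ⟪a, q l⟫ := by
    intro k l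
    simp only [a, InnerProductSpace.toDual_symm_apply]
    exact ((hs _ (subset_convexHull ℝ _ ⟨k, rfl⟩)).trans hst).trans
      (ht _ (subset_convexHull ℝ _ ⟨l, rfl⟩))
  have ha0 : -a ≠ 0 := by
    intro h
    obtain ⟨k⟩ := ‹Nonempty κ›
    simpa [neg_eq_zero.1 h] using ha k k
  obtain ⟨φ, hφ, ρ, hρ, haφ⟩ := exists_eq_smul_unitVec ha0
  have hz : ∀ k l, ⟪unitVec (φ + π), p k⟫ < ⟪unitVec (φ + π), q l⟫ := by
    intro k l
    have h := ha k l
    rw [← neg_neg a, haφ, ← smul_neg, ← unitVec_add_pi, real_inner_smul_left,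
      real_inner_smul_left] at h
    exact lt_of_mul_lt_mul_left h hρ.le
  have hnot : ¬ supportFun p (unitVec φ) ≤ supportFun q (unitVec φ) := by
    intro h
    obtain ⟨k, hk⟩ := exists_inner_eq_supportFun q (unitVec φ)
    have h1 := hz k k
    rw [unitVec_add_pi, inner_neg_left, inner_neg_left] at h1
    linarith [inner_le_supportFun p (unitVec φ) k]
  refine ⟨φ, hφ, fun x y z hx hxy hyz hz' hpx hpz => ?_⟩
  rcases le_total y (φ + π) with hy | hy
  · have hx' : φ < x := lt_of_le_of_ne hx fun h => hnot (h ▸ hpx)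
    rcases hxy.eq_or_lt with rfl | hxy
    · exact hpx
    exact supportFun_le_of_smul_eq hz
      (sin_nonneg_of_nonneg_of_le_pi (by linarith) (by linarith))
      (sin_nonneg_of_nonneg_of_le_pi (by linarith) (by linarith))
      (sin_pos_of_pos_of_lt_pi (by linarith) (by linarith)) (sin_smul_unitVec x y (φ + π)) hpx
  · have hz'' : z < φ + 2 * π := lt_of_le_of_ne hz' fun h => hnot (by
      rwa [h, unitVec_add_two_pi] at hpz)
    rcases hyz.eq_or_lt with rfl | hyz
    · exact hpz
    exact supportFun_le_of_smul_eq hz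
      (sin_nonneg_of_nonneg_of_le_pi (by linarith) (by linarith))
      (sin_nonneg_of_nonneg_of_le_pi (by linarith) (by linarith))
      (sin_pos_of_pos_of_lt_pi (by linarith) (by linarith))
      ((sin_smul_unitVec (φ + π) y z).trans (add_comm _ _)) hpz

/-- The support value of the `i`-th point set in direction `θ`, with ties broken by the index. -/
noncomputable def rank {n : ℕ} (p : Fin n → κ → Plane) (θ : ℝ) (i : Fin n) : ℝ ×ₗ Fin n :=
  toLex (supportFun (p i) (unitVec θ), i)

omit [Finite κ] [Nonempty κ] in
lemma rank_injective {n : ℕ} (p : Fin n → κ → Plane) (θ : ℝ) : Function.Injective (rank p θ) :=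
  fun _ _ h => congrArg (fun x => (ofLex x).2) h

omit [Finite κ] [Nonempty κ] in
lemma rank_lt_rank_iff {n : ℕ} {p : Fin n → κ → Plane} {i j : Fin n} (hij : i < j) (θ : ℝ) :
    rank p θ i < rank p θ j ↔ supportFun (p i) (unitVec θ) ≤ supportFun (p j) (unitVec θ) := by
  simp [rank, Prod.Lex.toLex_lt_toLex, hij, le_iff_lt_or_eq]

lemma rank_no_alternation {n : ℕ} {p : Fin n → κ → Plane}
    (hdisj : ∀ i j, i ≠ j →
      Disjoint (convexHull ℝ (Set.range (p i))) (convexHull ℝ (Set.range (p j))))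
    {i j : Fin n} (hij : i ≠ j) {a b c d : ℝ} (ha : -π < a) (hab : a < b) (hbc : b < c)
    (hcd : c < d) (hd : d ≤ π) :
    let F := fun θ => rank p θ i < rank p θ j
    ¬ (F a ∧ ¬ F b ∧ F c ∧ ¬ F d) ∧ ¬ (¬ F a ∧ F b ∧ ¬ F c ∧ F d) := by
  wlog hlt : i < j generalizing i j
  · have h := this hij.symm (lt_of_le_of_ne (not_lt.1 hlt) hij.symm)
    have hneg : ∀ θ, rank p θ i < rank p θ j ↔ ¬ rank p θ j < rank p θ i := fun θ => by
      rw [not_lt, le_iff_lt_or_eq, or_iff_left fun h => hij (rank_injective p θ h)]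
    simp only [hneg, not_not]
    exact h.symm
  obtain ⟨φ, hφ, hconn⟩ := exists_supportFun_le_connected (hdisj i j hij)
  simp only [rank_lt_rank_iff hlt]
  exact no_alternation
    (F := fun θ => supportFun (p i) (unitVec θ) ≤ supportFun (p j) (unitVec θ))
    (fun θ => by simp only [unitVec_add_two_pi]) hφ hconn ha hab hbc hcd hd

end Plane

lemma exists_separating_angle {ι : Type} {C : ι → Set Plane} (h : ShatteredByHalfplanes C)
    (T : Set ι) : ∃ θ ∈ Set.Ioc (-Real.pi) Real.pi, ∃ b : ℝ,
      ∀ i, C i ⊆ {x | ⟪unitVec θ, x⟫ ≤ b} ↔ i ∈ T := by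
  obtain ⟨_, ⟨a, ha, b, rfl⟩, hT⟩ := h T
  obtain ⟨θ, hθ, ρ, hρ, rfl⟩ := exists_eq_smul_unitVec ha
  refine ⟨θ, hθ, b / ρ, fun i => ?_⟩
  rw [← hT i]
  simp only [real_inner_smul_left, le_div_iff₀' hρ]

end HalfplaneShattering

open HalfplaneShattering in
/-- No family of four nonempty pairwise disjoint convex sets in the plane is shattered
by halfplanes. -/
theorem no_four_disjoint_convex_sets_shattered (C : Fin 4 → Set Plane)
    (hne : ∀ i, (C i).Nonempty)
    (hconv : ∀ i, Convex ℝ (C i))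
    (hdisj : ∀ i j, i ≠ j → Disjoint (C i) (C j)) :
    ¬ ShatteredByHalfplanes C := by
  intro hC
  choose θ hθ b hb using fun T : Finset (Fin 4) => exists_separating_angle hC (T : Set (Fin 4))
  have hpt : ∀ i (T : Finset (Fin 4)), ∃ x ∈ C i, i ∉ T → b T < ⟪unitVec (θ T), x⟫ := by
    intro i T
    by_cases hi : i ∈ T
    · obtain ⟨x, hx⟩ := hne i
      exact ⟨x, hx, fun h => absurd hi h⟩
    · obtain ⟨x, hx, hxb⟩ := Set.not_subset.1 (mt (hb T i).1 hi)
      exact ⟨x, hx, fun _ => not_le.1 hxb⟩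
  choose p hpC hpb using hpt
  have hhull : ∀ i, convexHull ℝ (Set.range (p i)) ⊆ C i := fun i =>
    convexHull_min (Set.range_subset_iff.2 (hpC i)) (hconv i)
  have hpdisj : ∀ i j, i ≠ j →
      Disjoint (convexHull ℝ (Set.range (p i))) (convexHull ℝ (Set.range (p j))) :=
    fun i j hij => (hdisj i j hij).mono (hhull i) (hhull j)
  have hprefix : ∀ T, IsPrefix (rank p (θ T)) T := by
    intro T i hi j hj
    obtain ⟨U, hU⟩ := exists_inner_eq_supportFun (p i) (unitVec (θ T))
    have h1 : ⟪unitVec (θ T), p i U⟫ ≤ b T := (hb T i).2 hi (hpC i U)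
    have h2 := (hpb j T hj).trans_le (inner_le_supportFun (p j) (unitVec (θ T)) T)
    exact Prod.Lex.toLex_lt_toLex.2 (Or.inl (by simpa only [← hU] using h1.trans_lt h2))
  let S : Finset ℝ := Finset.univ.image θ
  have : NeZero S.card := ⟨Finset.card_ne_zero.2 (Finset.univ_nonempty.image θ)⟩
  let e := S.orderEmbOfFin rfl
  have he : ∀ k, e k ∈ Set.Ioc (-Real.pi) Real.pi := by
    intro k
    obtain ⟨T, -, hT⟩ := Finset.mem_image.1 (S.orderEmbOfFin_mem rfl k)
    exact hT ▸ hθ T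
  have hcard := card_nontrivial_finset_le (fun k => rank p (e k)) (fun k => rank_injective p _)
    (fun T => by
      obtain ⟨k, hk⟩ : θ T ∈ Set.range e := by
        simp [e, S, Finset.range_orderEmbOfFin]
      exact ⟨k, hk ▸ hprefix T⟩)
    (fun i j k l hk hl => by
      have hij : i ≠ j := by rintro rfl; exact lt_irrefl _ hk.1
      exact descent_unique (P := fun k => rank p (e k) i < rank p (e k) j)
        (fun a b c d hab hbc hcd => rank_no_alternation hpdisj hij (he a).1
          (e.strictMono hab) (e.strictMono hbc) (e.strictMono hcd) (he d).2)
        ⟨hk.1, hk.2.not_gt⟩ ⟨hl.1, hl.2.not_gt⟩)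
  revert hcard
  decide
end

section
/- Let S be a family of n line segments in the plane ℝ², indexed by their endpoint pairs, such that the segments are in general position (no three of the 2n endpoints are collinear). Then the number of distinct subsets of S that are realized by halfplanes is at most 2n(n−1) + 2. -/
open RealInnerProductSpace

/-- The endpoints of an indexed family of segments (given by their endpoint pairs):
the endpoint of segment `x.1` selected by `x.2`. -/
def endpointOf {n : ℕ} (s : Fin n → Plane × Plane) (x : Fin n × Bool) : Plane :=
  if x.2 then (s x.1).2 else (s x.1).1

/-- A family of segments is in general position if no three of its `2n` endpoints are
collinear. -/
def InGeneralPosition {n : ℕ} (s : Fin n → Plane × Plane) : Prop :=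
  ∀ x y z : Fin n × Bool, x ≠ y → x ≠ z → y ≠ z →
    ¬ Collinear ℝ ({endpointOf s x, endpointOf s y, endpointOf s z} : Set Plane)

/-- Twice the signed area of the triangle `p q r`. -/
def signedArea (p q r : Plane) : ℝ :=
  (q 0 - p 0) * (r 1 - p 1) - (q 1 - p 1) * (r 0 - p 0)

theorem signedArea_swap (p q r : Plane) : signedArea q p r = -signedArea p q r := by
  unfold signedArea; ring

theorem collinear_of_signedArea_eq_zero {p q r : Plane} (h : signedArea p q r = 0) :
    Collinear ℝ ({p, q, r} : Set Plane) := by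
  by_cases hpq : q = p
  · subst hpq
    simpa using collinear_pair ℝ q r
  have hd : 0 < (q 0 - p 0) ^ 2 + (q 1 - p 1) ^ 2 := by
    by_contra! hle
    have h0 : q 0 - p 0 = 0 := by nlinarith [sq_nonneg (q 0 - p 0), sq_nonneg (q 1 - p 1)]
    have h1 : q 1 - p 1 = 0 := by nlinarith [sq_nonneg (q 0 - p 0), sq_nonneg (q 1 - p 1)]
    refine hpq ?_
    ext i
    fin_cases i
    · exact sub_eq_zero.mp h0
    · exact sub_eq_zero.mp h1
  rw [collinear_iff_of_mem (p₀ := p) (by simp)]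
  refine ⟨q - p, ?_⟩
  have hr : r = (((q 0 - p 0) * (r 0 - p 0) + (q 1 - p 1) * (r 1 - p 1)) /
      ((q 0 - p 0) ^ 2 + (q 1 - p 1) ^ 2)) • (q - p) +ᵥ p := by
    unfold signedArea at h
    ext i
    fin_cases i
    · simp
      field_simp
      linear_combination (-(q 1 - p 1)) * h
    · simp
      field_simp
      linear_combination (q 0 - p 0) * h
  rintro z (rfl | rfl | rfl)
  · exact ⟨0, by simp⟩
  · exact ⟨1, by simp⟩
  · exact ⟨_, hr⟩

/-- The value at `p` of the linear functional with unit normal vector at angle `θ`. -/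
noncomputable def height (p : Plane) (θ : ℝ) : ℝ := Real.cos θ * p 0 + Real.sin θ * p 1

theorem continuous_height (p : Plane) : Continuous (height p) := by
  unfold height; fun_prop

theorem height_add_pi (p : Plane) (θ : ℝ) : height p (θ + Real.pi) = -height p θ := by
  simp only [height, Real.cos_add_pi, Real.sin_add_pi]; ring

/-- The support function, in direction `θ`, of the segment with endpoints `P (k, b)`. -/
noncomputable def support {n : ℕ} (P : Fin n × Bool → Plane) (k : Fin n) (θ : ℝ) : ℝ :=
  max (height (P (k, false)) θ) (height (P (k, true)) θ)

theorem continuous_support {n : ℕ} (P : Fin n × Bool → Plane) (k : Fin n) :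
    Continuous (support P k) :=
  (continuous_height _).max (continuous_height _)

theorem height_le_support {n : ℕ} (P : Fin n × Bool → Plane) (k : Fin n) (b : Bool) (θ : ℝ) :
    height (P (k, b)) θ ≤ support P k θ := by
  cases b
  · exact le_max_left _ _
  · exact le_max_right _ _

theorem exists_height_eq_support {n : ℕ} (P : Fin n × Bool → Plane) (k : Fin n) (θ : ℝ) :
    ∃ b, height (P (k, b)) θ = support P k θ := by
  rcases max_choice (height (P (k, false)) θ) (height (P (k, true)) θ) with h | h
  · exact ⟨false, h.symm⟩
  · exact ⟨true, h.symm⟩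

/-- The endpoints `P x` and `P y` span a common supporting line of their two segments, and
`T` consists of the segments lying on the side of these two, except for that of `y`. -/
structure IsBitangent {n : ℕ} (P : Fin n × Bool → Plane) (T : Set (Fin n))
    (x y : Fin n × Bool) : Prop where
  left_mem : x.1 ∈ T
  right_notMem : y.1 ∉ T
  le_of_mem : ∀ k ∈ T, ∀ b, signedArea (P x) (P y) (P (k, b)) ≤ 0
  le_right : ∀ b, signedArea (P x) (P y) (P (y.1, b)) ≤ 0
  ge_of_notMem : ∀ k ∉ T, ∃ b, 0 ≤ signedArea (P x) (P y) (P (k, b))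

theorem IsBitangent.fst_ne {n : ℕ} {P : Fin n × Bool → Plane} {T : Set (Fin n)}
    {x y : Fin n × Bool} (h : IsBitangent P T x y) : x.1 ≠ y.1 :=
  fun he => h.right_notMem (he ▸ h.left_mem)

theorem IsBitangent.mem_iff {n : ℕ} {P : Fin n × Bool → Plane}
    (hP : ∀ x y z, x ≠ y → x ≠ z → y ≠ z → signedArea (P x) (P y) (P z) ≠ 0)
    {T : Set (Fin n)} {x y : Fin n × Bool} (h : IsBitangent P T x y) (k : Fin n) :
    k ∈ T ↔ k ≠ y.1 ∧ ∀ b, signedArea (P x) (P y) (P (k, b)) ≤ 0 := by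
  refine ⟨fun hk => ⟨fun he => h.right_notMem (he ▸ hk), h.le_of_mem k hk⟩, ?_⟩
  rintro ⟨hky, hk⟩
  by_contra hkT
  obtain ⟨b, hb⟩ := h.ge_of_notMem k hkT
  refine hP x y (k, b) (fun he => h.fst_ne (congrArg Prod.fst he)) ?_ ?_ (le_antisymm (hk b) hb)
  · rintro rfl
    exact hkT h.left_mem
  · rintro rfl
    exact hky rfl

theorem IsBitangent.not_swap {n : ℕ} {P : Fin n × Bool → Plane}
    (hP : ∀ x y z, x ≠ y → x ≠ z → y ≠ z → signedArea (P x) (P y) (P z) ≠ 0)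
    {T T' : Set (Fin n)} {x y : Fin n × Bool} (h : IsBitangent P T x y) :
    ¬ IsBitangent P T' y x := by
  intro h'
  have h1 := h.le_of_mem x.1 h.left_mem (!x.2)
  have h2 := h'.le_right (!x.2)
  rw [signedArea_swap] at h2
  refine hP x y (x.1, !x.2) (fun he => h.fst_ne (congrArg Prod.fst he)) ?_ ?_ (by linarith)
  · intro he
    have := congrArg Prod.snd he
    simp at this
  · intro he
    exact h.fst_ne (congrArg Prod.fst he).symm

/-- No segment lies in the interior of another one: half a turn suffices to see this. -/
theorem exists_support_le {n : ℕ} (P : Fin n × Bool → Plane) (i j : Fin n) (θ₀ : ℝ) :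
    ∃ θ, θ₀ ≤ θ ∧ support P j θ ≤ support P i θ := by
  obtain ⟨φ, hφ, h0⟩ : ∃ φ, θ₀ ≤ φ ∧ height (P (j, true)) φ = height (P (j, false)) φ := by
    set F : ℝ → ℝ := fun θ => height (P (j, true)) θ - height (P (j, false)) θ with hF
    have hc : Continuous F := (continuous_height _).sub (continuous_height _)
    have hπ : F (θ₀ + Real.pi) = -F θ₀ := by simp only [hF, height_add_pi]; ring
    have hmem : (0 : ℝ) ∈ Set.uIcc (F θ₀) (F (θ₀ + Real.pi)) := by
      rw [hπ, Set.mem_uIcc]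
      rcases le_total (F θ₀) 0 with h | h
      · left; constructor <;> linarith
      · right; constructor <;> linarith
    obtain ⟨φ, hφ, h⟩ := intermediate_value_uIcc hc.continuousOn hmem
    rw [Set.uIcc_of_le (by linarith [Real.pi_pos])] at hφ
    exact ⟨φ, hφ.1, sub_eq_zero.mp h⟩
  by_cases h : support P j φ ≤ support P i φ
  · exact ⟨φ, hφ, h⟩
  refine ⟨φ + Real.pi, by linarith [Real.pi_pos], ?_⟩
  have h1 : support P j (φ + Real.pi) = -support P j φ := by
    simp only [support, height_add_pi, h0, max_self]
  have h2 := height_le_support P i true φ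
  have h3 := height_le_support P i true (φ + Real.pi)
  rw [height_add_pi] at h3
  linarith

/-- Rotating a separating direction until it stops separating yields a bitangent. -/
theorem exists_isBitangent {n : ℕ} {P : Fin n × Bool → Plane}
    (hP : ∀ x y z, x ≠ y → x ≠ z → y ≠ z → signedArea (P x) (P y) (P z) ≠ 0)
    {T : Set (Fin n)} (hne : T.Nonempty) (hnu : Tᶜ.Nonempty) {θ₀ : ℝ}
    (hsep : ∀ i ∈ T, ∀ j ∉ T, support P i θ₀ < support P j θ₀) :
    ∃ x y, IsBitangent P T x y := by
  set C : Set ℝ := Set.Ici θ₀ ∩ ⋃ i ∈ T, ⋃ j ∈ Tᶜ, {θ | support P j θ ≤ support P i θ} with hC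
  have hCmem : ∀ θ, θ ∈ C ↔ θ₀ ≤ θ ∧ ∃ i ∈ T, ∃ j ∉ T, support P j θ ≤ support P i θ := by
    intro θ; simp [hC]
  have hclosed : IsClosed C := by
    refine isClosed_Ici.inter ?_
    refine T.toFinite.isClosed_biUnion fun i _ => Tᶜ.toFinite.isClosed_biUnion fun j _ => ?_
    exact isClosed_le (continuous_support P j) (continuous_support P i)
  have hbdd : BddBelow C := ⟨θ₀, fun θ h => h.1⟩
  have hCne : C.Nonempty := by
    obtain ⟨i, hi⟩ := hne
    obtain ⟨j, hj⟩ := hnu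
    obtain ⟨θ, h1, h2⟩ := exists_support_le P i j θ₀
    exact ⟨θ, (hCmem θ).2 ⟨h1, i, hi, j, hj, h2⟩⟩
  set t := sInf C with ht
  obtain ⟨ht0, i, hi, j, hj, hij⟩ := (hCmem t).1 (hclosed.csInf_mem hCne hbdd)
  have hlt : θ₀ < t := by
    refine lt_of_le_of_ne ht0 fun he => ?_
    rw [← he] at hij
    exact (hsep i hi j hj).not_ge hij
  have hbefore : ∀ θ ∈ Set.Ico θ₀ t, ∀ i ∈ T, ∀ j ∉ T, support P i θ < support P j θ := by
    intro θ hθ i hi j hj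
    by_contra! hle
    exact (csInf_le hbdd ((hCmem θ).2 ⟨hθ.1, i, hi, j, hj, hle⟩)).not_gt hθ.2
  have hev : ∀ᶠ θ in nhdsWithin t (Set.Iio t), θ ∈ Set.Ico θ₀ t := Ico_mem_nhdsLT hlt
  have hat : ∀ i ∈ T, ∀ j ∉ T, support P i t ≤ support P j t := by
    intro i hi j hj
    refine le_of_tendsto_of_tendsto (b := nhdsWithin t (Set.Iio t))
      ((continuous_support P i).continuousAt.tendsto.mono_left nhdsWithin_le_nhds)
      ((continuous_support P j).continuousAt.tendsto.mono_left nhdsWithin_le_nhds) ?_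
    filter_upwards [hev] with θ hθ using (hbefore θ hθ i hi j hj).le
  obtain ⟨b, hb⟩ := exists_height_eq_support P i t
  obtain ⟨c, hc⟩ := exists_height_eq_support P j t
  have hxy : height (P (i, b)) t = height (P (j, c)) t := by
    rw [hb, hc]; exact le_antisymm (hat i hi j hj) hij
  have hijne : i ≠ j := fun h => hj (h ▸ hi)
  have hcs := Real.sin_sq_add_cos_sq t
  have hother : height (P (j, !c)) t < height (P (j, c)) t := by
    refine lt_of_le_of_ne (hc ▸ height_le_support P j (!c) t) fun he => ?_
    refine hP (i, b) (j, c) (j, !c) (by simp [hijne]) (by simp [hijne]) (by simp) ?_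
    rw [hxy.symm] at he
    simp only [height] at hxy he
    simp only [signedArea]
    set u0 := P (j, c) 0 - P (i, b) 0 with hu0
    set u1 := P (j, c) 1 - P (i, b) 1 with hu1
    set v0 := P (j, !c) 0 - P (i, b) 0 with hv0
    set v1 := P (j, !c) 1 - P (i, b) 1 with hv1
    have e1 : Real.cos t * u0 + Real.sin t * u1 = 0 := by rw [hu0, hu1]; linarith
    have e2 : Real.cos t * v0 + Real.sin t * v1 = 0 := by rw [hv0, hv1]; linarith
    linear_combination (-(u0 * v1 - u1 * v0)) * hcs + (Real.cos t * v1 - Real.sin t * v0) * e1 +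
      (Real.sin t * u0 - Real.cos t * u1) * e2
  set μ := (P (j, c) 0 - P (i, b) 0) * Real.sin t - (P (j, c) 1 - P (i, b) 1) * Real.cos t with hμ
  have hpos : 0 < μ := by
    have hev2 : ∀ᶠ θ in nhdsWithin t (Set.Iio t), height (P (j, !c)) θ < height (P (j, c)) θ :=
      nhdsWithin_le_nhds
        ((continuous_height _).continuousAt.eventually_lt (continuous_height _).continuousAt hother)
    have hev4 : ∀ᶠ θ in nhdsWithin t (Set.Iio t), θ ∈ Set.Ioo (t - Real.pi) t :=
      Ioo_mem_nhdsLT (by linarith [Real.pi_pos])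
    obtain ⟨θ, h1, h2, h4⟩ := (hev.and (hev2.and hev4)).exists
    have hlt' : height (P (i, b)) θ < height (P (j, c)) θ := by
      refine (height_le_support P i b θ).trans_lt ((hbefore θ h1 i hi j hj).trans_le ?_)
      cases c
      · exact max_le le_rfl h2.le
      · exact max_le h2.le le_rfl
    have hs : 0 < Real.sin (t - θ) := Real.sin_pos_of_pos_of_lt_pi (by linarith [h4.2])
      (by linarith [h4.1])
    refine pos_of_mul_pos_right ?_ hs.le
    have : Real.sin (t - θ) * μ = height (P (j, c)) θ - height (P (i, b)) θ := by
      simp only [height] at hxy ⊢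
      rw [Real.sin_sub, hμ]
      linear_combination (Real.cos θ * (P (j, c) 0 - P (i, b) 0) +
        Real.sin θ * (P (j, c) 1 - P (i, b) 1)) * hcs +
        (Real.cos t * Real.cos θ + Real.sin t * Real.sin θ) * hxy
    rw [this]; linarith
  have harea : ∀ z, signedArea (P (i, b)) (P (j, c)) z = μ * (height z t - height (P (i, b)) t) := by
    intro z
    simp only [height] at hxy ⊢
    simp only [signedArea, hμ]
    linear_combination (-((P (j, c) 0 - P (i, b) 0) * (z 1 - P (i, b) 1) -
      (P (j, c) 1 - P (i, b) 1) * (z 0 - P (i, b) 0))) * hcs -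
      (Real.cos t * (z 1 - P (i, b) 1) - Real.sin t * (z 0 - P (i, b) 0)) * hxy
  have hle : ∀ z, height z t ≤ height (P (i, b)) t →
      signedArea (P (i, b)) (P (j, c)) z ≤ 0 := fun z hz => by
    rw [harea]; exact mul_nonpos_of_nonneg_of_nonpos hpos.le (by linarith)
  refine ⟨(i, b), (j, c), hi, hj, fun k hk d => hle _ ?_, fun d => hle _ ?_, fun k hk => ?_⟩
  · linarith [height_le_support P k d t, hat k hk j hj]
  · linarith [height_le_support P j d t]
  · obtain ⟨d, hd⟩ := exists_height_eq_support P k t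
    refine ⟨d, ?_⟩
    rw [harea]
    exact mul_nonneg hpos.le (by linarith [hat i hi k hk])

/-- A halfplane separates the segments it contains from the others in some direction. -/
theorem IsHalfplane.exists_support_lt {n : ℕ} (s : Fin n → Plane × Plane) {h : Set Plane}
    (hh : IsHalfplane h) {T : Set (Fin n)}
    (hT : ∀ i : Fin n, segment ℝ (s i).1 (s i).2 ⊆ h ↔ i ∈ T) :
    ∃ θ, ∀ i ∈ T, ∀ j ∉ T, support (endpointOf s) i θ < support (endpointOf s) j θ := by
  obtain ⟨a, ha, b, rfl⟩ := hh
  set z : ℂ := ⟨a 0, a 1⟩ with hz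
  have hz0 : 0 < ‖z‖ := by
    rw [norm_pos_iff]
    intro h0
    refine ha ?_
    ext i
    fin_cases i
    · exact congrArg Complex.re h0
    · exact congrArg Complex.im h0
  have hinner : ∀ p : Plane, ⟪a, p⟫ = ‖z‖ * height p z.arg := by
    intro p
    have h1 : ‖z‖ * Real.cos z.arg = a 0 := Complex.norm_mul_cos_arg z
    have h2 : ‖z‖ * Real.sin z.arg = a 1 := Complex.norm_mul_sin_arg z
    rw [height, mul_add, ← mul_assoc, ← mul_assoc, h1, h2]
    simp [PiLp.inner_apply, Fin.sum_univ_two, mul_comm]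
  have hconv : Convex ℝ {x : Plane | ⟪a, x⟫ ≤ b} :=
    convex_halfSpace_le (innerₛₗ ℝ a).isLinear b
  have key : ∀ i, i ∈ T ↔ ‖z‖ * support (endpointOf s) i z.arg ≤ b := by
    intro i
    rw [← hT i, support, mul_max_of_nonneg _ _ hz0.le, max_le_iff, ← hinner, ← hinner]
    exact ⟨fun h => ⟨h (left_mem_segment ℝ _ _), h (right_mem_segment ℝ _ _)⟩,
      fun h => hconv.segment_subset h.1 h.2⟩
  refine ⟨z.arg, fun i hi j hj => ?_⟩
  rw [key] at hi hj
  exact lt_of_mul_lt_mul_left (hi.trans_lt (not_le.mp hj)) hz0.le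

theorem card_le_of_isBitangent {n : ℕ} {P : Fin n × Bool → Plane}
    (hP : ∀ x y z, x ≠ y → x ≠ z → y ≠ z → signedArea (P x) (P y) (P z) ≠ 0)
    (A : Finset (Set (Fin n))) (hA : ∀ T ∈ A, ∃ x y, IsBitangent P T x y) :
    A.card ≤ 2 * n * (n - 1) := by
  classical
  obtain rfl | ⟨T₀, hT₀⟩ := A.eq_empty_or_nonempty
  · simp
  obtain ⟨x₀, -⟩ := hA T₀ hT₀
  have : Nonempty (Fin n × Bool) := ⟨x₀⟩
  choose! x y hxy using hA
  have hcard : (A ×ˢ (Finset.univ : Finset Bool)).card ≤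
      ((Finset.univ : Finset (Fin n)).offDiag ×ˢ (Finset.univ : Finset (Bool × Bool))).card := by
    refine Finset.card_le_card_of_injOn
      (fun p => if p.2 then (((x p.1).1, (y p.1).1), ((x p.1).2, (y p.1).2))
        else (((y p.1).1, (x p.1).1), ((y p.1).2, (x p.1).2))) ?_ ?_
    · rintro ⟨T, c⟩ hp
      have hT := (hxy T (by simpa using hp)).fst_ne
      cases c <;> simp [hT, hT.symm]
    · rintro ⟨T, c⟩ hp ⟨T', c'⟩ hp' he
      have hT := hxy T (by simpa using hp)
      have hT' := hxy T' (by simpa using hp')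
      have same (e1 : x T = x T') (e2 : y T = y T') : T = T' := by
        ext k
        rw [hT.mem_iff hP, hT'.mem_iff hP, e1, e2]
      have swap (e1 : x T = y T') (e2 : y T = x T') : False := by
        rw [← e1, ← e2] at hT'
        exact hT.not_swap hP hT'
      cases c <;> cases c' <;> simp at he ⊢
      · exact same (Prod.ext he.1.2 he.2.2) (Prod.ext he.1.1 he.2.1)
      · exact swap (Prod.ext he.1.2 he.2.2) (Prod.ext he.1.1 he.2.1)
      · exact swap (Prod.ext he.1.1 he.2.1) (Prod.ext he.1.2 he.2.2)
      · exact same (Prod.ext he.1.1 he.2.1) (Prod.ext he.1.2 he.2.2)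
  simp only [Finset.card_product, Finset.offDiag_card, Finset.card_univ, Fintype.card_prod,
    Fintype.card_bool, Fintype.card_fin] at hcard
  rw [mul_assoc, Nat.mul_sub_one]
  omega

/-- For a family of `n` segments in general position in the plane, at most
`2n(n-1) + 2` subsets are realized by halfplanes. -/
theorem realized_subsets_of_segments_le (n : ℕ) (s : Fin n → Plane × Plane)
    (hgp : InGeneralPosition s) :
    Set.ncard {T : Set (Fin n) | ∃ h : Set Plane, IsHalfplane h ∧
        ∀ i : Fin n, segment ℝ (s i).1 (s i).2 ⊆ h ↔ i ∈ T}
      ≤ 2 * n * (n - 1) + 2 := by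
  classical
  have hP : ∀ x y z, x ≠ y → x ≠ z → y ≠ z →
      signedArea (endpointOf s x) (endpointOf s y) (endpointOf s z) ≠ 0 :=
    fun x y z hxy hxz hyz h0 => hgp x y z hxy hxz hyz (collinear_of_signedArea_eq_zero h0)
  set R := {T : Set (Fin n) | ∃ h : Set Plane, IsHalfplane h ∧
        ∀ i : Fin n, segment ℝ (s i).1 (s i).2 ⊆ h ↔ i ∈ T} with hR
  have hA : (R \ {∅, Set.univ}).ncard ≤ 2 * n * (n - 1) := by
    rw [Set.ncard_eq_toFinset_card']
    refine card_le_of_isBitangent hP _ fun T hT => ?_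
    simp only [Set.mem_toFinset, Set.mem_sdiff, Set.mem_insert_iff, Set.mem_singleton_iff,
      not_or] at hT
    obtain ⟨⟨h, hh, hT⟩, h1, h2⟩ := hT
    obtain ⟨θ, hθ⟩ := hh.exists_support_lt s hT
    exact exists_isBitangent hP (Set.nonempty_iff_ne_empty.2 h1) (Set.nonempty_compl.2 h2) hθ
  have hpair : ({∅, Set.univ} : Set (Set (Fin n))).ncard ≤ 2 :=
    (Set.ncard_insert_le _ _).trans (by simp)
  have := Set.ncard_le_ncard_sdiff_add_ncard R {∅, Set.univ}
  omega
end

section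
/- No family of six line segments in the plane ℝ² (possibly intersecting, not necessarily in general position) is shattered by halfplanes. Equivalently, the VC-dimension of halfplanes with respect to line segments in the plane is at most 5. -/
open RealInnerProductSpace

/-! ### Prefixes of a cyclic sequence of linear orders -/

section Counting

theorem Fin.exists_and_not_add_one {n : ℕ} {P : Fin (n + 1) → Prop} {a b : Fin (n + 1)}
    (ha : P a) (hb : ¬ P b) : ∃ t, P t ∧ ¬ P (t + 1) := by
  by_contra! h
  have key : ∀ c, P (a + c) := by
    intro c
    induction c using Fin.induction with
    | zero => simpa using ha
    | succ c ih =>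
      have := h _ ih
      rwa [add_assoc, Fin.coeSucc_eq_succ] at this
  exact hb (by simpa using key (b - a))

variable {ι α : Type*} [Fintype ι] [LinearOrder α]

/-- The number of indices with a strictly smaller key. -/
def keyRank (K : ι → α) (i : ι) : ℕ := (Finset.univ.filter fun j => K j < K i).card

theorem keyRank_lt_keyRank {K : ι → α} {i j : ι} (h : K i < K j) : keyRank K i < keyRank K j := by
  refine Finset.card_lt_card (Finset.ssubset_iff_of_subset ?_ |>.2 ⟨i, by simpa using h, by simp⟩)
  intro k hk
  simp only [Finset.mem_filter, Finset.mem_univ, true_and] at hk ⊢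
  exact hk.trans h

theorem keyRank_injective {K : ι → α} (hK : Function.Injective K) :
    Function.Injective (keyRank K) := by
  intro i j hij
  rcases lt_trichotomy (K i) (K j) with h | h | h
  · exact absurd hij (keyRank_lt_keyRank h).ne
  · exact hK h
  · exact absurd hij (keyRank_lt_keyRank h).ne'

theorem card_keyRank_lt_le {K : ι → α} (hK : Function.Injective K) (k : ℕ) :
    (Finset.univ.filter fun i => keyRank K i < k).card ≤ k := by
  have := Finset.card_le_card_of_injOn (s := Finset.univ.filter fun i => keyRank K i < k)
    (t := Finset.range k) (keyRank K) (fun i hi => by simpa using hi)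
    (keyRank_injective hK).injOn
  simpa using this

theorem eq_filter_keyRank_lt {K : ι → α} (hK : Function.Injective K) {T : Finset ι}
    (hT : ∀ i ∈ T, keyRank K i < T.card) :
    T = Finset.univ.filter fun i => keyRank K i < T.card :=
  Finset.eq_of_subset_of_card_le (fun i hi => by simpa using hT i hi) (card_keyRank_lt_le hK _)

theorem mem_iff_keyRank_lt_card {K : ι → α} {T : Finset ι}
    (hT : ∀ i ∈ T, ∀ j ∉ T, K i < K j) (i : ι) : i ∈ T ↔ keyRank K i < T.card := by
  constructor
  · intro hi
    refine Finset.card_lt_card (Finset.ssubset_iff_of_subset ?_ |>.2 ⟨i, hi, by simp⟩)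
    intro j hj
    by_contra hjT
    simp only [Finset.mem_filter, Finset.mem_univ, true_and] at hj
    exact lt_asymm hj (hT i hi j hjT)
  · intro h
    by_contra hi
    refine absurd h (not_lt.2 (Finset.card_le_card fun j hj => ?_))
    simpa using hT j hj i hi

/-- A proper nonempty prefix set is lost at some step of the cyclic sequence. -/
theorem exists_keyRank_step [DecidableEq ι] {n : ℕ} {K : Fin (n + 1) → ι → α}
    (hK : ∀ t, Function.Injective (K t))
    (hsep : ∀ T : Finset ι, ∃ t, ∀ i ∈ T, ∀ j ∉ T, K t i < K t j)
    {T : Finset ι} (hne : T ≠ ∅) (huniv : T ≠ Finset.univ) :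
    ∃ t i, (T = Finset.univ.filter fun j => keyRank (K t) j < T.card) ∧
      keyRank (K t) i < T.card ∧ T.card ≤ keyRank (K (t + 1)) i := by
  obtain ⟨a, ha⟩ := hsep T
  obtain ⟨b, hb⟩ := hsep Tᶜ
  have hPa : ∀ i ∈ T, keyRank (K a) i < T.card := fun i hi =>
    (mem_iff_keyRank_lt_card ha i).1 hi
  have hPb : ¬ ∀ i ∈ T, keyRank (K b) i < T.card := by
    intro h
    obtain ⟨i, hi⟩ := Finset.nonempty_iff_ne_empty.2 hne
    obtain ⟨j, hj⟩ : ∃ j, j ∉ T := by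
      by_contra! hall
      exact huniv (Finset.eq_univ_iff_forall.2 hall)
    have hj1 := (mem_iff_keyRank_lt_card hb j).1 (by simpa using hj)
    have hi1 : Tᶜ.card ≤ keyRank (K b) i :=
      not_lt.1 fun h' => (by simpa using hi : i ∉ Tᶜ) ((mem_iff_keyRank_lt_card hb i).2 h')
    have hi2 := h i hi
    apply hj
    rw [eq_filter_keyRank_lt (hK b) h]
    simp only [Finset.mem_filter, Finset.mem_univ, true_and]
    omega
  obtain ⟨t, ht, ht'⟩ := Fin.exists_and_not_add_one
    (P := fun t => ∀ i ∈ T, keyRank (K t) i < T.card) hPa hPb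
  push Not at ht'
  obtain ⟨i, hi, hi'⟩ := ht'
  exact ⟨t, i, eq_filter_keyRank_lt (hK t) ht, ht i hi, hi'⟩

theorem keyRank_sub_le (K K' : ι → α) (i : ι) :
    keyRank K' i - keyRank K i ≤
      (Finset.univ.filter fun j => ¬ K j < K i ∧ K' j < K' i).card := by
  classical
  refine (Finset.le_card_sdiff _ _).trans (Finset.card_le_card fun j hj => ?_)
  simp only [Finset.mem_sdiff, Finset.mem_filter, Finset.mem_univ, true_and] at hj ⊢
  exact ⟨hj.2, hj.1⟩

/-- If every subset is a prefix of one of the orders in a cyclic sequence, then the sequence has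
at least as many inversions between consecutive orders as there are proper nonempty subsets. -/
theorem card_proper_subsets_le_sum_inversions [DecidableEq ι] {n : ℕ} {K : Fin (n + 1) → ι → α}
    (hK : ∀ t, Function.Injective (K t))
    (hsep : ∀ T : Finset ι, ∃ t, ∀ i ∈ T, ∀ j ∉ T, K t i < K t j) :
    (Finset.univ.filter fun T : Finset ι => T ≠ ∅ ∧ T ≠ Finset.univ).card ≤
      ∑ i, ∑ j, (Finset.univ.filter fun t =>
        ¬ K t j < K t i ∧ K (t + 1) j < K (t + 1) i).card := by
  have hstep : ∀ T : Finset ι, T ≠ ∅ ∧ T ≠ Finset.univ → ∃ ti : Fin (n + 1) × ι,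
      (T = Finset.univ.filter fun j => keyRank (K ti.1) j < T.card) ∧
      keyRank (K ti.1) ti.2 < T.card ∧ T.card ≤ keyRank (K (ti.1 + 1)) ti.2 := by
    intro T h
    obtain ⟨t, i, hti⟩ := exists_keyRank_step hK hsep h.1 h.2
    exact ⟨(t, i), hti⟩
  rcases isEmpty_or_nonempty ι with hι | hι
  · simp [Finset.eq_empty_of_isEmpty]
  choose! f hf using hstep
  calc _ ≤ ((Finset.univ : Finset (Fin (n + 1) × ι)).sigma fun ti =>
        Finset.Ioc (keyRank (K ti.1) ti.2) (keyRank (K (ti.1 + 1)) ti.2)).card := by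
        refine Finset.card_le_card_of_injOn (fun T => ⟨f T, T.card⟩) ?_ ?_
        · intro T hT
          have := hf T (by simpa using hT)
          simpa using this.2
        · intro T hT T' hT' heq
          simp only [Sigma.mk.injEq, heq_eq_eq] at heq
          rw [(hf T (by simpa using hT)).1, (hf T' (by simpa using hT')).1, heq.1, heq.2]
    _ = ∑ ti : Fin (n + 1) × ι, (keyRank (K (ti.1 + 1)) ti.2 - keyRank (K ti.1) ti.2) := by
        simp
    _ ≤ ∑ ti : Fin (n + 1) × ι, (Finset.univ.filter fun j =>
          ¬ K ti.1 j < K ti.1 ti.2 ∧ K (ti.1 + 1) j < K (ti.1 + 1) ti.2).card :=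
        Finset.sum_le_sum fun ti _ => keyRank_sub_le _ _ _
    _ = _ := by
        simp only [Finset.card_filter]
        rw [Fintype.sum_prod_type, Finset.sum_comm]
        exact Finset.sum_congr rfl fun i _ => Finset.sum_comm

end Counting

/-! ### Cones of directions -/

section Direction

/-- The scalar product of `v` with the unit vector of angle `θ`. -/
noncomputable def dirHeight (v : Plane) (θ : ℝ) : ℝ := v 0 * Real.cos θ + v 1 * Real.sin θ

theorem dirHeight_sub (v w : Plane) (θ : ℝ) :
    dirHeight (v - w) θ = dirHeight v θ - dirHeight w θ := by
  simp only [dirHeight, PiLp.sub_apply]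
  ring

theorem dirHeight_add_pi (v : Plane) (θ : ℝ) : dirHeight v (θ + Real.pi) = -dirHeight v θ := by
  simp only [dirHeight, Real.cos_add_pi, Real.sin_add_pi]
  ring

theorem dirHeight_add_two_pi (v : Plane) (θ : ℝ) :
    dirHeight v (θ + 2 * Real.pi) = dirHeight v θ := by
  simp only [dirHeight, Real.cos_add_two_pi, Real.sin_add_two_pi]

theorem dirHeight_pos_of_between {v : Plane} {α β γ : ℝ} (hαβ : α ≤ β) (hβγ : β ≤ γ)
    (hlt : γ - α < Real.pi) (hα : 0 < dirHeight v α) (hγ : 0 < dirHeight v γ) :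
    0 < dirHeight v β := by
  rcases hαβ.eq_or_lt with rfl | hαβ
  · exact hα
  have key : Real.sin (γ - α) * dirHeight v β =
      Real.sin (γ - β) * dirHeight v α + Real.sin (β - α) * dirHeight v γ := by
    simp only [dirHeight, Real.sin_sub]
    ring
  have h1 : 0 < Real.sin (γ - α) := Real.sin_pos_of_pos_of_lt_pi (by linarith) hlt
  have h2 : 0 ≤ Real.sin (γ - β) := Real.sin_nonneg_of_nonneg_of_le_pi (by linarith) (by linarith)
  have h3 : 0 < Real.sin (β - α) := Real.sin_pos_of_pos_of_lt_pi (by linarith) (by linarith)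
  refine pos_of_mul_pos_right (a := Real.sin (γ - α)) ?_ h1.le
  rw [key]
  positivity

/-- The angles of an open convex cone cut out by two halfplanes. -/
def InCone (v w : Plane) (θ : ℝ) : Prop := 0 < dirHeight v θ ∧ 0 < dirHeight w θ

theorem inCone_add_two_pi {v w : Plane} {θ : ℝ} :
    InCone v w (θ + 2 * Real.pi) ↔ InCone v w θ := by
  simp only [InCone, dirHeight_add_two_pi]

theorem InCone.or_of_cyclic {v w : Plane} {α β γ δ : ℝ} (hα : InCone v w α) (hγ : InCone v w γ)
    (hαβ : α ≤ β) (hβγ : β ≤ γ) (hγδ : γ ≤ δ) (hδα : δ ≤ α + 2 * Real.pi) :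
    InCone v w β ∨ InCone v w δ := by
  rcases lt_trichotomy (γ - α) Real.pi with h | h | h
  · exact .inl ⟨dirHeight_pos_of_between hαβ hβγ h hα.1 hγ.1,
      dirHeight_pos_of_between hαβ hβγ h hα.2 hγ.2⟩
  · obtain rfl : γ = α + Real.pi := by linarith
    have h1 := hα.1
    have h2 := hγ.1
    rw [dirHeight_add_pi] at h2
    linarith
  · have hα' := inCone_add_two_pi.2 hα
    exact .inr ⟨dirHeight_pos_of_between hγδ hδα (by linarith) hγ.1 hα'.1,
      dirHeight_pos_of_between hγδ hδα (by linarith) hγ.2 hα'.2⟩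

/-- The angle following `θ t` in the cyclic order, lifted to be at least `θ t`. -/
noncomputable def nextAngle {n : ℕ} (θ : Fin (n + 1) → ℝ) (t : Fin (n + 1)) : ℝ :=
  if t = Fin.last n then θ 0 + 2 * Real.pi else θ (t + 1)

variable {n : ℕ} {θ : Fin (n + 1) → ℝ}

theorem inCone_nextAngle {v w : Plane} {t : Fin (n + 1)} :
    InCone v w (nextAngle θ t) ↔ InCone v w (θ (t + 1)) := by
  unfold nextAngle
  split_ifs with h
  · rw [inCone_add_two_pi, h, Fin.last_add_one]
  · rfl

theorem le_nextAngle (hmono : Monotone θ) (hθ : ∀ s t, θ s ≤ θ t + 2 * Real.pi)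
    (t : Fin (n + 1)) : θ t ≤ nextAngle θ t := by
  unfold nextAngle
  split_ifs with h
  · exact hθ _ _
  · exact hmono (Fin.lt_add_one_iff.2 (Fin.lt_last_iff_ne_last.2 h)).le

theorem nextAngle_le_of_lt (hmono : Monotone θ) {s t : Fin (n + 1)} (hst : s < t) :
    nextAngle θ s ≤ θ t := by
  unfold nextAngle
  rw [if_neg (hst.trans_le (Fin.le_last t)).ne]
  exact hmono (Fin.add_one_le_of_lt hst)

theorem nextAngle_le_add_two_pi (hmono : Monotone θ) (hθ : ∀ s t, θ s ≤ θ t + 2 * Real.pi)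
    (s t : Fin (n + 1)) : nextAngle θ s ≤ θ t + 2 * Real.pi := by
  unfold nextAngle
  split_ifs with h
  · linarith [hmono (Fin.zero_le t)]
  · exact hθ _ _

open Classical in
theorem card_exit_cone_le_one (hmono : Monotone θ) (hθ : ∀ s t, θ s ≤ θ t + 2 * Real.pi)
    (v w : Plane) :
    (Finset.univ.filter fun t => InCone v w (θ t) ∧ ¬ InCone v w (θ (t + 1))).card ≤ 1 := by
  have key : ∀ s t, s < t → InCone v w (θ s) ∧ ¬ InCone v w (θ (s + 1)) →
      InCone v w (θ t) ∧ ¬ InCone v w (θ (t + 1)) → False := by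
    intro s t hst hs ht
    simp only [← inCone_nextAngle (θ := θ)] at hs ht
    rcases hs.1.or_of_cyclic ht.1 (le_nextAngle hmono hθ s) (nextAngle_le_of_lt hmono hst)
      (le_nextAngle hmono hθ t) (nextAngle_le_add_two_pi hmono hθ t s) with h | h
    exacts [hs.2 h, ht.2 h]
  refine Finset.card_le_one.2 fun s hs t ht => ?_
  simp only [Finset.mem_filter, Finset.mem_univ, true_and] at hs ht
  by_contra hne
  rcases lt_or_gt_of_ne hne with h | h
  exacts [key s t h hs ht, key t s h ht hs]

open Classical in
theorem card_enter_cone_le_one (hmono : Monotone θ) (hθ : ∀ s t, θ s ≤ θ t + 2 * Real.pi)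
    (v w : Plane) :
    (Finset.univ.filter fun t => ¬ InCone v w (θ t) ∧ InCone v w (θ (t + 1))).card ≤ 1 := by
  have key : ∀ s t, s < t → ¬ InCone v w (θ s) ∧ InCone v w (θ (s + 1)) →
      ¬ InCone v w (θ t) ∧ InCone v w (θ (t + 1)) → False := by
    intro s t hst hs ht
    simp only [← inCone_nextAngle (θ := θ)] at hs ht
    rcases hs.2.or_of_cyclic ht.2 (nextAngle_le_of_lt hmono hst) (le_nextAngle hmono hθ t)
      (nextAngle_le_add_two_pi hmono hθ t s) (by linarith [le_nextAngle hmono hθ s]) with h | h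
    exacts [ht.1 h, hs.1 (inCone_add_two_pi.1 h)]
  refine Finset.card_le_one.2 fun s hs t ht => ?_
  simp only [Finset.mem_filter, Finset.mem_univ, true_and] at hs ht
  by_contra hne
  rcases lt_or_gt_of_ne hne with h | h
  exacts [key s t h hs ht, key t s h ht hs]

/-- The support function of the segment with endpoints `c.1` and `c.2`. -/
noncomputable def segHeight (c : Plane × Plane) (θ : ℝ) : ℝ :=
  max (dirHeight c.1 θ) (dirHeight c.2 θ)

theorem segHeight_lt_iff (c d : Plane × Plane) (θ : ℝ) :
    segHeight c θ < segHeight d θ ↔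
      InCone (d.1 - c.1) (d.1 - c.2) θ ∨ InCone (d.2 - c.1) (d.2 - c.2) θ := by
  simp only [segHeight, InCone, dirHeight_sub, sub_pos]
  rw [lt_max_iff, max_lt_iff, max_lt_iff]

theorem card_exit_segHeight_lt_le_two (hmono : Monotone θ)
    (hθ : ∀ s t, θ s ≤ θ t + 2 * Real.pi) (c d : Plane × Plane) :
    (Finset.univ.filter fun t => segHeight c (θ t) < segHeight d (θ t) ∧
      ¬ segHeight c (θ (t + 1)) < segHeight d (θ (t + 1))).card ≤ 2 := by
  classical
  refine (Finset.card_le_card (fun t ht => ?_)).trans ((Finset.card_union_le _ _).trans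
    (add_le_add (card_exit_cone_le_one hmono hθ (d.1 - c.1) (d.1 - c.2))
      (card_exit_cone_le_one hmono hθ (d.2 - c.1) (d.2 - c.2))))
  simp only [segHeight_lt_iff, Finset.mem_union, Finset.mem_filter, Finset.mem_univ,
    true_and] at ht ⊢
  tauto

theorem card_enter_segHeight_lt_le_two (hmono : Monotone θ)
    (hθ : ∀ s t, θ s ≤ θ t + 2 * Real.pi) (c d : Plane × Plane) :
    (Finset.univ.filter fun t => ¬ segHeight c (θ t) < segHeight d (θ t) ∧
      segHeight c (θ (t + 1)) < segHeight d (θ (t + 1))).card ≤ 2 := by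
  classical
  refine (Finset.card_le_card (fun t ht => ?_)).trans ((Finset.card_union_le _ _).trans
    (add_le_add (card_enter_cone_le_one hmono hθ (d.1 - c.1) (d.1 - c.2))
      (card_enter_cone_le_one hmono hθ (d.2 - c.1) (d.2 - c.2))))
  simp only [segHeight_lt_iff, Finset.mem_union, Finset.mem_filter, Finset.mem_univ,
    true_and] at ht ⊢
  tauto

end Direction

/-! ### Segments ordered by their support functions -/

theorem segment_subset_halfplane_iff (a : Plane) (b : ℝ) (p q : Plane) :
    segment ℝ p q ⊆ {x : Plane | ⟪a, x⟫ ≤ b} ↔ max ⟪a, p⟫ ⟪a, q⟫ ≤ b := by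
  have hconv : Convex ℝ {x : Plane | ⟪a, x⟫ ≤ b} :=
    convex_halfSpace_le (innerSL ℝ a).toLinearMap.isLinear b
  rw [max_le_iff]
  exact ⟨fun h => ⟨h (left_mem_segment ℝ p q), h (right_mem_segment ℝ p q)⟩,
    fun h => hconv.segment_subset h.1 h.2⟩

/-- Every nonzero linear functional is a positive multiple of a height in some direction. -/
theorem exists_inner_eq_mul_dirHeight {a : Plane} (ha : a ≠ 0) :
    ∃ r : ℝ, 0 < r ∧ ∃ θ ∈ Set.Ioc (-Real.pi) Real.pi, ∀ x : Plane, ⟪a, x⟫ = r * dirHeight x θ := by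
  set z : ℂ := ⟨a 0, a 1⟩ with hz
  refine ⟨‖z‖, ?_, z.arg, Complex.arg_mem_Ioc z, fun x => ?_⟩
  · rw [norm_pos_iff]
    intro h
    apply ha
    ext i
    fin_cases i
    · simpa [hz] using congrArg Complex.re h
    · simpa [hz] using congrArg Complex.im h
  · have h0 : ‖z‖ * Real.cos z.arg = a 0 := Complex.norm_mul_cos_arg z
    have h1 : ‖z‖ * Real.sin z.arg = a 1 := Complex.norm_mul_sin_arg z
    simp only [dirHeight, PiLp.inner_apply, Fin.sum_univ_two, RCLike.inner_apply, conj_trivial]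
    rw [← h0, ← h1]
    ring

theorem ShatteredByHalfplanes.exists_angle {ι : Type} {s : ι → Plane × Plane}
    (h : ShatteredByHalfplanes fun i => segment ℝ (s i).1 (s i).2) (T : Set ι) :
    ∃ θ ∈ Set.Ioc (-Real.pi) Real.pi,
      ∀ i ∈ T, ∀ j ∉ T, segHeight (s i) θ < segHeight (s j) θ := by
  obtain ⟨_, ⟨a, ha, b, rfl⟩, hT⟩ := h T
  obtain ⟨r, hr, θ, hθ, hinner⟩ := exists_inner_eq_mul_dirHeight ha
  refine ⟨θ, hθ, fun i hi j hj => ?_⟩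
  have hle : ∀ k, r * segHeight (s k) θ ≤ b ↔ k ∈ T := fun k => by
    rw [segHeight, mul_max_of_nonneg _ _ hr.le, ← hinner, ← hinner, ← segment_subset_halfplane_iff]
    exact hT k
  have h1 := (hle i).2 hi
  have h2 := not_le.1 (mt (hle j).1 hj)
  exact lt_of_mul_lt_mul_left (h1.trans_lt h2) hr.le

/-- The height of a segment, with ties broken by its index. -/
noncomputable def segKey {m : ℕ} (s : Fin m → Plane × Plane) (θ : ℝ) (i : Fin m) : ℝ ×ₗ Fin m :=
  toLex (segHeight (s i) θ, i)

theorem segKey_injective {m : ℕ} (s : Fin m → Plane × Plane) (θ : ℝ) :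
    Function.Injective (segKey s θ) := fun _ _ h => congrArg (fun x => (ofLex x).2) h

theorem segKey_lt_iff_of_lt {m : ℕ} (s : Fin m → Plane × Plane) (θ : ℝ) {i j : Fin m}
    (hij : i < j) : segKey s θ i < segKey s θ j ↔ ¬ segHeight (s j) θ < segHeight (s i) θ := by
  simp [segKey, Prod.Lex.toLex_lt_toLex, hij, le_iff_lt_or_eq]

theorem segKey_lt_iff_of_le {m : ℕ} (s : Fin m → Plane × Plane) (θ : ℝ) {i j : Fin m}
    (hij : i ≤ j) : segKey s θ j < segKey s θ i ↔ segHeight (s j) θ < segHeight (s i) θ := by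
  simp [segKey, Prod.Lex.toLex_lt_toLex, hij]

theorem card_segKey_inversions_le {m n : ℕ} {θ : Fin (n + 1) → ℝ} (s : Fin m → Plane × Plane)
    (hmono : Monotone θ) (hθ : ∀ s t, θ s ≤ θ t + 2 * Real.pi) (i j : Fin m) :
    (Finset.univ.filter fun t => ¬ segKey s (θ t) j < segKey s (θ t) i ∧
      segKey s (θ (t + 1)) j < segKey s (θ (t + 1)) i).card ≤ if i = j then 0 else 2 := by
  rcases lt_trichotomy i j with h | rfl | h
  · simp only [segKey_lt_iff_of_le s _ h.le, if_neg h.ne]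
    exact card_enter_segHeight_lt_le_two hmono hθ _ _
  · simp
  · simp only [segKey_lt_iff_of_lt s _ h, if_neg h.ne', not_not]
    exact card_exit_segHeight_lt_le_two hmono hθ _ _

/-- No family of six segments in the plane (possibly intersecting, not necessarily in
general position) is shattered by halfplanes. -/
theorem no_six_segments_shattered (s : Fin 6 → Plane × Plane) :
    ¬ ShatteredByHalfplanes (fun i => segment ℝ (s i).1 (s i).2) := by
  intro h
  choose φ hφ hsep using fun T : Finset (Fin 6) => h.exists_angle (T : Set (Fin 6))
  let e : Finset (Fin 6) ≃ Fin (63 + 1) := Fintype.equivFinOfCardEq (by simp)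
  let f : Fin (63 + 1) → ℝ := φ ∘ e.symm
  let θ : Fin (63 + 1) → ℝ := f ∘ Tuple.sort f
  have hmono : Monotone θ := Tuple.monotone_sort f
  have hθ : ∀ s t, θ s ≤ θ t + 2 * Real.pi := fun s t => by
    have h1 : θ s ≤ Real.pi := (hφ _).2
    have h2 : -Real.pi < θ t := (hφ _).1
    linarith
  have hprefix : ∀ T : Finset (Fin 6), ∃ t, ∀ i ∈ T, ∀ j ∉ T,
      segKey s (θ t) i < segKey s (θ t) j := by
    intro T
    refine ⟨(Tuple.sort f).symm (e T), fun i hi j hj => ?_⟩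
    have hT : θ ((Tuple.sort f).symm (e T)) = φ T := by simp [θ, f]
    rw [hT]
    exact Prod.Lex.toLex_lt_toLex.2 (.inl (hsep T i hi j hj))
  have hle := (card_proper_subsets_le_sum_inversions
    (fun t => segKey_injective s (θ t)) hprefix).trans
    (Finset.sum_le_sum fun i _ => Finset.sum_le_sum fun j _ =>
      card_segKey_inversions_le s hmono hθ i j)
  revert hle
  decide
end

section
/- Let 𝒞 be a family of n nonempty convex sets in the plane ℝ² that is shattered by halfplanes. Then the number of unordered pairs of distinct members of 𝒞 that intersect each other is at least n(n−3)/6. -/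
open RealInnerProductSpace

/-- The number of levels at which the initial segments of two orders on four elements differ is at
most the number of pairs on which the orders disagree. -/
theorem perm_card_level_ne_le (ρ ρ' : Equiv.Perm (Fin 4)) :
    ∑ k ∈ Finset.Icc 1 3, (if (Finset.univ.filter fun i => (ρ i : ℕ) < k) =
        (Finset.univ.filter fun i => (ρ' i : ℕ) < k) then 0 else 1) ≤
      ∑ p : Fin 4 × Fin 4 with p.1 < p.2,
        (if (ρ p.1 < ρ p.2 ↔ ρ' p.1 < ρ' p.2) then 0 else 1) := by
  revert ρ ρ'
  decide +kernel

theorem filter_perm_lt_card (ρ : Equiv.Perm (Fin 4)) (T : Finset (Fin 4))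
    (h : ∀ i ∈ T, ∀ j, j ∉ T → ρ i < ρ j) :
    (Finset.univ.filter fun i => (ρ i : ℕ) < T.card) = T := by
  revert ρ T
  decide +kernel

open Fin.CommRing in
/-- A nonconstant cyclic sequence changes at least as often as it takes values. -/
theorem card_image_le_card_cyclic_changes {m : ℕ} {β : Type*} [DecidableEq β]
    (f : Fin (m + 1) → β) (h : 1 < (Finset.univ.image f).card) :
    (Finset.univ.image f).card ≤ (Finset.univ.filter fun a => f a ≠ f (a + 1)).card := by
  refine le_trans (Finset.card_le_card ?_)
    (Finset.card_image_le (s := Finset.univ.filter fun a => f a ≠ f (a + 1)) (f := f))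
  intro b hb
  obtain ⟨a, -, rfl⟩ := Finset.mem_image.1 hb
  by_contra hcon
  have hstep : ∀ c, f c = f a → f (c + 1) = f a := by
    intro c hc
    by_contra hne
    exact hcon (Finset.mem_image.2 ⟨c, by simp [hc, Ne.symm hne], hc⟩)
  have hadd : ∀ k : ℕ, f (a + (k : Fin (m + 1))) = f a := by
    intro k
    induction k with
    | zero => simp
    | succ k ih =>
      have := hstep _ ih
      rwa [add_assoc, ← Nat.cast_succ] at this
  have hconst : ∀ c, f c = f a := fun c => by
    simpa using hadd (c - a : Fin (m + 1)).val
  obtain ⟨x, hx, y, hy, hxy⟩ := Finset.one_lt_card.1 h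
  obtain ⟨c, -, rfl⟩ := Finset.mem_image.1 hx
  obtain ⟨d, -, rfl⟩ := Finset.mem_image.1 hy
  exact hxy ((hconst c).trans (hconst d).symm)

/-- No four increasing indices carry alternating truth values of `s`. -/
def AlternationFree {α : Type*} [LE α] (s : α → Prop) : Prop :=
  ∀ a b c d, a ≤ b → b ≤ c → c ≤ d → ¬ ((s a ↔ ¬ s b) ∧ (s b ↔ ¬ s c) ∧ (s c ↔ ¬ s d))

open Classical in
theorem AlternationFree.card_cyclic_changes_le {m : ℕ} {s : Fin (m + 1) → Prop}
    (h : AlternationFree s) :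
    (Finset.univ.filter fun a => ¬ (s a ↔ s (a + 1))).card ≤ 2 := by
  by_contra hcon
  have hcard := not_le.1 hcon
  set S := Finset.univ.filter fun a => ¬ (s a ↔ s (a + 1)) with hS
  let e := S.orderEmbOfCardLe (k := 3) hcard
  have he : ∀ k, ¬ (s (e k) ↔ s (e k + 1)) := fun k => by
    have := S.orderEmbOfCardLe_mem hcard k
    simpa [hS] using this
  have h01 : e 0 < e 1 := e.strictMono (by decide)
  have h12 : e 1 < e 2 := e.strictMono (by decide)
  have hsucc : ∀ {x y : Fin (m + 1)}, x < y → x ≤ x + 1 ∧ x + 1 ≤ y := by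
    intro x y hxy
    have hx : (x + 1).val = x.val + 1 := Fin.val_add_one_of_lt (lt_of_lt_of_le hxy (Fin.le_last y))
    simp only [Fin.le_def, Fin.lt_def] at *
    omega
  have h0 := he 0
  have h1 := he 1
  have h2 := he 2
  obtain ⟨a1, a2⟩ := hsucc h01
  obtain ⟨b1, b2⟩ := hsucc h12
  rcases eq_or_lt_of_le (Fin.le_last (e 2)) with hl | hl
  · rw [hl, Fin.last_add_one] at h2
    rw [hl] at b2
    have z := Fin.zero_le (e 0)
    by_cases s0 : s (e 0) ↔ s 0
    · by_cases s1 : s (e 0) ↔ s (e 1)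
      · exact h _ _ _ _ a1 a2 b1 (by grind only)
      · exact h _ _ _ _ h01.le b1 b2 (by grind only)
    · exact h _ _ _ _ z a1 (a2.trans (b1.trans b2)) (by grind only)
  · obtain ⟨c1, c2⟩ := hsucc hl
    by_cases s1 : s (e 0) ↔ s (e 1)
    · exact h _ _ _ _ a1 a2 b1 (by grind only)
    · by_cases s2 : s (e 1) ↔ s (e 2)
      · exact h _ _ _ _ h01.le b1 b2 (by grind only)
      · exact h _ _ _ _ h01.le h12.le c1 (by grind only)

/-- A cyclic sequence of orders on four elements in which every subset occurs as an initial segment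
must, for some pair, alternate the order of that pair. -/
theorem no_alternationFree_perm_sequence {m : ℕ} (ρ : Fin (m + 1) → Equiv.Perm (Fin 4))
    (halt : ∀ i j, i < j → AlternationFree fun a => ρ a i < ρ a j)
    (hreal : ∀ T : Finset (Fin 4), ∃ a, ∀ i ∈ T, ∀ j, j ∉ T → ρ a i < ρ a j) : False := by
  classical
  let L : ℕ → Fin (m + 1) → Finset (Fin 4) :=
    fun k a => Finset.univ.filter fun i => (ρ a i : ℕ) < k
  have hlevel : ∀ k ∈ Finset.Icc 1 3,
      Nat.choose 4 k ≤ ∑ a, if L k a = L k (a + 1) then 0 else 1 := by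
    intro k hk
    have hsub : Finset.univ.powersetCard k ⊆ Finset.univ.image (L k) := by
      intro T hT
      obtain ⟨a, ha⟩ := hreal T
      refine Finset.mem_image.2 ⟨a, Finset.mem_univ _, ?_⟩
      have := filter_perm_lt_card (ρ a) T ha
      rwa [(Finset.mem_powersetCard.1 hT).2] at this
    have hcard := Finset.card_le_card hsub
    rw [Finset.card_powersetCard, Finset.card_univ, Fintype.card_fin] at hcard
    have h1 : 1 < Nat.choose 4 k := by
      clear hsub hcard; revert k; decide
    refine hcard.trans ((card_image_le_card_cyclic_changes (L k) (h1.trans_le hcard)).trans ?_)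
    simp [Finset.card_filter]
  have hpair : ∀ p ∈ (Finset.univ : Finset (Fin 4 × Fin 4)).filter fun p => p.1 < p.2,
      (∑ a, if (ρ a p.1 < ρ a p.2 ↔ ρ (a + 1) p.1 < ρ (a + 1) p.2) then 0 else 1) ≤ 2 := by
    intro p hp
    refine le_trans (le_of_eq ?_) (halt p.1 p.2 (Finset.mem_filter.1 hp).2).card_cyclic_changes_le
    rw [Finset.card_filter]
    exact Finset.sum_congr rfl fun a _ => by split_ifs <;> simp_all
  have h1 := Finset.sum_le_sum hlevel
  have h2 := Finset.sum_le_sum hpair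
  rw [Finset.sum_comm] at h1 h2
  have h3 := Finset.sum_le_sum fun a (_ : a ∈ Finset.univ) =>
    perm_card_level_ne_le (ρ a) (ρ (a + 1))
  have h4 : ∑ k ∈ Finset.Icc 1 3, Nat.choose 4 k = 14 := by decide
  have h5 : ∑ p : Fin 4 × Fin 4 with p.1 < p.2, 2 = 12 := by decide
  have h6 := (h1.trans h3).trans h2
  omega

open Real in
/-- A predicate on angles which is star-shaped about `φ` on the period centred at `φ` cannot
alternate along four increasing angles of a period. -/
theorem not_alternating_of_star {S : ℝ → Prop} (hper : ∀ x, S (x - 2 * π) ↔ S x) {φ : ℝ}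
    (hleft : ∀ x y, φ - π ≤ x → x ≤ y → y ≤ φ → S x → S y)
    (hright : ∀ x y, x ≤ φ + π → y ≤ x → φ ≤ y → S x → S y)
    {a b c d : ℝ} (ha : φ - π ≤ a) (ha' : a < φ + π) (hab : a ≤ b) (hbc : b ≤ c) (hcd : c ≤ d)
    (hda : d < a + 2 * π) : ¬ ((S a ↔ ¬ S b) ∧ (S b ↔ ¬ S c) ∧ (S c ↔ ¬ S d)) := by
  have hconn : ∀ x y z, φ - π ≤ x → x ≤ y → y ≤ z → z ≤ φ + π → S x → S z → S y := by
    intro x y z hx hxy hyz hz sx sz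
    rcases le_total y φ with hy | hy
    · exact hleft x y hx hxy hy sx
    · exact hright z y hz hyz hy sz
  rintro ⟨h1, h2, h3⟩
  rcases lt_or_ge d (φ + π) with hd | hd
  · by_cases sa : S a
    · exact h1.1 sa (hconn a b c ha hab hbc (by linarith) sa (by tauto))
    · have sc : ¬ S c := by tauto
      exact sc (hconn b c d (by linarith) hbc hcd hd.le (by tauto) (by tauto))
  rcases lt_or_ge c (φ + π) with hc | hc
  · by_cases sa : S a
    · exact h1.1 sa (hconn a b c ha hab hbc hc.le sa (by tauto))
    · exact sa (hconn (d - 2 * π) a b (by linarith) (by linarith) hab (by linarith)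
        ((hper d).2 (by tauto)) (by tauto))
  by_cases sa : S a
  · have sd : ¬ S d := by tauto
    exact sd ((hper d).1 (hconn (c - 2 * π) (d - 2 * π) a (by linarith) (by linarith)
      (by linarith) ha'.le ((hper c).2 (by tauto)) sa))
  rcases lt_or_ge b (φ + π) with hb | hb
  · exact sa (hconn (d - 2 * π) a b (by linarith) (by linarith) hab hb.le
      ((hper d).2 (by tauto)) (by tauto))
  · have sc : ¬ S c := by tauto
    exact sc ((hper c).1 (hconn (b - 2 * π) (c - 2 * π) (d - 2 * π) (by linarith) (by linarith)
      (by linarith) (by linarith) ((hper b).2 (by tauto)) ((hper d).2 (by tauto))))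

/-- The inner product of a point with the unit vector of angle `θ`. -/
noncomputable def angularCoord (θ : ℝ) (x : Plane) : ℝ := Real.cos θ * x 0 + Real.sin θ * x 1

theorem angularCoord_sub_two_pi (θ : ℝ) (x : Plane) :
    angularCoord (θ - 2 * Real.pi) x = angularCoord θ x := by
  simp [angularCoord]

theorem angularCoord_add_pi (θ : ℝ) (x : Plane) :
    angularCoord (θ + Real.pi) x = -angularCoord θ x := by
  simp only [angularCoord, Real.cos_add_pi, Real.sin_add_pi]
  ring

theorem sin_mul_angularCoord (θ ψ φ : ℝ) (x : Plane) :
    Real.sin (φ - θ) * angularCoord ψ x =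
      Real.sin (φ - ψ) * angularCoord θ x + Real.sin (ψ - θ) * angularCoord φ x := by
  simp only [angularCoord, Real.sin_sub]
  ring

theorem exists_inner_eq_mul_angularCoord {a : Plane} (ha : a ≠ 0) :
    ∃ r > 0, ∃ θ ∈ Set.Ioc (-Real.pi) Real.pi, ∀ x, ⟪a, x⟫ = r * angularCoord θ x := by
  let z : ℂ := ⟨a 0, a 1⟩
  have hz : z ≠ 0 := by
    intro h
    apply ha
    ext i
    fin_cases i
    · simpa [z] using congrArg Complex.re h
    · simpa [z] using congrArg Complex.im h
  refine ⟨‖z‖, norm_pos_iff.2 hz, z.arg, Complex.arg_mem_Ioc z, fun x => ?_⟩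
  have h1 := Complex.norm_mul_cos_arg z
  have h2 := Complex.norm_mul_sin_arg z
  rw [angularCoord, mul_add, ← mul_assoc, ← mul_assoc, h1, h2]
  simp [z, PiLp.inner_apply, Fin.sum_univ_two, mul_comm]

section Support

variable {ι : Type*} [Fintype ι] [Nonempty ι]

/-- The support function of a finite family of points, as a function of the angle. -/
noncomputable def angularSupport (p : ι → Plane) (θ : ℝ) : ℝ :=
  Finset.univ.sup' Finset.univ_nonempty fun s => angularCoord θ (p s)

theorem angularSupport_lt_iff {p q : ι → Plane} {θ : ℝ} :
    angularSupport p θ < angularSupport q θ ↔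
      ∃ t, ∀ s, angularCoord θ (p s) < angularCoord θ (q t) := by
  simp [angularSupport, Finset.lt_sup'_iff]

theorem angularSupport_lt_of_combination {p q : ι → Plane} {θ ψ φ α β γ : ℝ}
    (hφ : ∀ s t, angularCoord φ (p s) < angularCoord φ (q t))
    (hθ : angularSupport p θ < angularSupport q θ) (hγ : 0 < γ) (hα : 0 < α) (hβ : 0 ≤ β)
    (h : ∀ x, γ * angularCoord ψ x = α * angularCoord θ x + β * angularCoord φ x) :
    angularSupport p ψ < angularSupport q ψ := by
  rw [angularSupport_lt_iff] at *
  obtain ⟨t, ht⟩ := hθ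
  refine ⟨t, fun s => lt_of_mul_lt_mul_left ?_ hγ.le⟩
  rw [h, h]
  exact add_lt_add_of_lt_of_le (mul_lt_mul_of_pos_left (ht s) hα)
    (mul_le_mul_of_nonneg_left (hφ s t).le hβ)

theorem angularSupport_lt_of_separated {p q : ι → Plane} {φ : ℝ}
    (hφ : ∀ s t, angularCoord φ (p s) < angularCoord φ (q t)) :
    angularSupport p φ < angularSupport q φ :=
  angularSupport_lt_iff.2 ⟨Classical.arbitrary ι, fun s => hφ s _⟩

theorem not_angularSupport_lt_of_antipodal {p q : ι → Plane} {θ φ : ℝ}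
    (hφ : ∀ s t, angularCoord φ (p s) < angularCoord φ (q t))
    (h : ∀ x, angularCoord φ x = -angularCoord θ x) :
    ¬ angularSupport p θ < angularSupport q θ := by
  rw [angularSupport_lt_iff]
  rintro ⟨t, ht⟩
  have h1 := ht t
  have h2 := hφ t t
  rw [h, h] at h2
  linarith

theorem angularSupport_lt_of_le_of_le {p q : ι → Plane} {θ ψ φ : ℝ}
    (hφ : ∀ s t, angularCoord φ (p s) < angularCoord φ (q t))
    (hθφ : φ - Real.pi ≤ θ) (hθψ : θ ≤ ψ) (hψφ : ψ ≤ φ)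
    (hθ : angularSupport p θ < angularSupport q θ) : angularSupport p ψ < angularSupport q ψ := by
  rcases hψφ.eq_or_lt with rfl | hψφ
  · exact angularSupport_lt_of_separated hφ
  rcases hθφ.eq_or_lt with rfl | hθφ
  · refine absurd hθ (not_angularSupport_lt_of_antipodal hφ fun x => ?_)
    rw [← angularCoord_add_pi, sub_add_cancel]
  exact angularSupport_lt_of_combination hφ hθ
    (Real.sin_pos_of_pos_of_lt_pi (by linarith) (by linarith))
    (Real.sin_pos_of_pos_of_lt_pi (by linarith) (by linarith))
    (Real.sin_nonneg_of_nonneg_of_le_pi (by linarith) (by linarith))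
    (sin_mul_angularCoord θ ψ φ)

theorem angularSupport_lt_of_ge_of_ge {p q : ι → Plane} {θ ψ φ : ℝ}
    (hφ : ∀ s t, angularCoord φ (p s) < angularCoord φ (q t))
    (hθφ : θ ≤ φ + Real.pi) (hψθ : ψ ≤ θ) (hφψ : φ ≤ ψ)
    (hθ : angularSupport p θ < angularSupport q θ) : angularSupport p ψ < angularSupport q ψ := by
  rcases hφψ.eq_or_lt with rfl | hφψ
  · exact angularSupport_lt_of_separated hφ
  rcases hθφ.eq_or_lt with rfl | hθφ
  · refine absurd hθ (not_angularSupport_lt_of_antipodal hφ fun x => ?_)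
    rw [angularCoord_add_pi, neg_neg]
  refine angularSupport_lt_of_combination (γ := Real.sin (θ - φ)) (α := Real.sin (ψ - φ))
    (β := Real.sin (θ - ψ)) hφ hθ
    (Real.sin_pos_of_pos_of_lt_pi (by linarith) (by linarith))
    (Real.sin_pos_of_pos_of_lt_pi (by linarith) (by linarith))
    (Real.sin_nonneg_of_nonneg_of_le_pi (by linarith) (by linarith)) fun x => ?_
  rw [sin_mul_angularCoord φ ψ θ, add_comm]

/-- Two families of points with disjoint convex hulls are strictly separated in some direction,
whose angle can be taken in any prescribed period. -/
theorem exists_angularCoord_lt {p q : ι → Plane}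
    (h : Disjoint (convexHull ℝ (Set.range p)) (convexHull ℝ (Set.range q))) (x : ℝ) :
    ∃ φ, φ - Real.pi ≤ x ∧ x < φ + Real.pi ∧
      ∀ s t, angularCoord φ (p s) < angularCoord φ (q t) := by
  obtain ⟨f, u, v, hu, huv, hv⟩ := geometric_hahn_banach_compact_closed
    (convex_convexHull ℝ _) ((Set.finite_range p).isCompact_convexHull ℝ)
    (convex_convexHull ℝ _) ((Set.finite_range q).isClosed_convexHull ℝ) h
  have hf : ∀ s t, f (p s) < f (q t) := fun s t =>
    (hu _ (subset_convexHull ℝ _ ⟨s, rfl⟩)).trans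
      (huv.trans (hv _ (subset_convexHull ℝ _ ⟨t, rfl⟩)))
  let a : Plane := (InnerProductSpace.toDual ℝ Plane).symm f
  have ha : ∀ y, ⟪a, y⟫ = f y := fun y => InnerProductSpace.toDual_symm_apply
  have ha0 : a ≠ 0 := by
    intro h0
    have := hf (Classical.arbitrary ι) (Classical.arbitrary ι)
    rw [← ha, ← ha, h0] at this
    simp at this
  obtain ⟨r, hr, θ, -, hθ⟩ := exists_inner_eq_mul_angularCoord ha0
  obtain ⟨k, ⟨hk1, hk2⟩, -⟩ := existsUnique_add_zsmul_mem_Ico Real.two_pi_pos (-θ) (-x - Real.pi)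
  rw [zsmul_eq_mul] at hk1 hk2
  refine ⟨θ - k * (2 * Real.pi), by linarith, by linarith, fun s t => ?_⟩
  have hst := hf s t
  rw [← ha, ← ha, hθ, hθ] at hst
  have hk : ∀ y, angularCoord (θ - k * (2 * Real.pi)) y = angularCoord θ y := fun y => by
    rw [angularCoord, Real.cos_sub_int_mul_two_pi, Real.sin_sub_int_mul_two_pi, angularCoord]
  rw [hk, hk]
  exact lt_of_mul_lt_mul_left hst hr.le

theorem alternationFree_angularSupport_lt {α : Type*} [Preorder α] {p q : ι → Plane}
    (h : Disjoint (convexHull ℝ (Set.range p)) (convexHull ℝ (Set.range q)))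
    {θ : α → ℝ} (hθ : Monotone θ) (hmem : ∀ a, θ a ∈ Set.Ioc (-Real.pi) Real.pi) :
    AlternationFree fun a => angularSupport p (θ a) < angularSupport q (θ a) := by
  intro a b c d hab hbc hcd
  obtain ⟨φ, h1, h2, hφ⟩ := exists_angularCoord_lt h (θ a)
  refine not_alternating_of_star (S := fun x => angularSupport p x < angularSupport q x)
    (fun x => ?_) (fun x y => angularSupport_lt_of_le_of_le hφ)
    (fun x y => angularSupport_lt_of_ge_of_ge hφ) h1 h2 (hθ hab) (hθ hbc) (hθ hcd) ?_
  · simp only [angularSupport_lt_iff, angularCoord_sub_two_pi]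
  · have := (hmem a).1
    have := (hmem d).2
    linarith

end Support

theorem AlternationFree.not {α : Type*} [LE α] {s : α → Prop} (h : AlternationFree s) :
    AlternationFree fun a => ¬ s a := by
  intro a b c d hab hbc hcd
  have := h a b c d hab hbc hcd
  tauto

theorem exists_perm_lt_iff_lt {n : ℕ} {α : Type*} [LinearOrder α] {v : Fin n → α}
    (hv : Function.Injective v) :
    ∃ ρ : Equiv.Perm (Fin n), ∀ i j, ρ i < ρ j ↔ v i < v j := by
  have hmono : StrictMono (v ∘ Tuple.sort v) :=
    (Tuple.monotone_sort v).strictMono_of_injective (hv.comp (Tuple.sort v).injective)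
  refine ⟨(Tuple.sort v).symm, fun i j => ?_⟩
  simpa using (hmono.lt_iff_lt (a := (Tuple.sort v).symm i) (b := (Tuple.sort v).symm j)).symm

/-- Four pairwise disjoint convex sets in the plane are not shattered by halfplanes. -/
theorem not_shatteredByHalfplanes_of_pairwise_disjoint {C : Fin 4 → Set Plane}
    (hconv : ∀ i, Convex ℝ (C i)) (hdisj : Pairwise fun i j => Disjoint (C i) (C j)) :
    ¬ ShatteredByHalfplanes C := by
  classical
  intro hsh
  have hdir : ∀ T : Finset (Fin 4), ∃ θ ∈ Set.Ioc (-Real.pi) Real.pi, ∃ b : ℝ,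
      ∀ i, (∀ x ∈ C i, angularCoord θ x ≤ b) ↔ i ∈ T := by
    intro T
    obtain ⟨_, ⟨a, ha, b, rfl⟩, hT⟩ := hsh T
    obtain ⟨r, hr, θ, hθ, hin⟩ := exists_inner_eq_mul_angularCoord ha
    refine ⟨θ, hθ, b / r, fun i => ?_⟩
    rw [← Finset.mem_coe, ← hT i]
    simp only [Set.subset_def, Set.mem_ofPred_eq, hin, le_div_iff₀ hr, mul_comm r]
  choose θ hθ b hb using hdir
  have hpt : ∀ (T : Finset (Fin 4)) (j : Fin 4),
      ∃ x ∈ C j, j ∉ T → b T < angularCoord (θ T) x := by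
    intro T j
    by_cases hj : j ∈ T
    · have h0 := mt (hb ∅ j).1 (Finset.notMem_empty j)
      push Not at h0
      obtain ⟨x, hx, -⟩ := h0
      exact ⟨x, hx, fun h => absurd hj h⟩
    · have h0 := mt (hb T j).1 hj
      push Not at h0
      obtain ⟨x, hx, hbx⟩ := h0
      exact ⟨x, hx, fun _ => hbx⟩
  choose q hqC hqb using hpt
  let p : Fin 4 → Finset (Fin 4) → Plane := fun j T => q T j
  have hhull : ∀ i, convexHull ℝ (Set.range (p i)) ⊆ C i := fun i =>
    convexHull_min (Set.range_subset_iff.2 fun T => hqC T i) (hconv i)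
  have hpd : ∀ i j, i ≠ j →
      Disjoint (convexHull ℝ (Set.range (p i))) (convexHull ℝ (Set.range (p j))) :=
    fun i j hij => (hdisj hij).mono (hhull i) (hhull j)
  let e : Fin (15 + 1) ≃ Finset (Fin 4) := (Fintype.equivFinOfCardEq (by decide)).symm
  let Θ : Fin (15 + 1) → ℝ := (θ ∘ e) ∘ Tuple.sort (θ ∘ e)
  have hmono : Monotone Θ := Tuple.monotone_sort (θ ∘ e)
  have hmem : ∀ a, Θ a ∈ Set.Ioc (-Real.pi) Real.pi := fun a => hθ _
  have hperm : ∀ a, ∃ ρ : Equiv.Perm (Fin 4), ∀ i j, ρ i < ρ j ↔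
      toLex (angularSupport (p i) (Θ a), i) < toLex (angularSupport (p j) (Θ a), j) := fun a =>
    exists_perm_lt_iff_lt (v := fun i => toLex (angularSupport (p i) (Θ a), i))
      fun i j hij => congrArg Prod.snd (toLex.injective hij)
  choose ρ hρ using hperm
  refine no_alternationFree_perm_sequence ρ (fun i j hij => ?_) fun T => ?_
  · have heq : (fun a => ρ a i < ρ a j) =
        fun a => ¬ angularSupport (p j) (Θ a) < angularSupport (p i) (Θ a) := by
      funext a
      rw [hρ, Prod.Lex.toLex_lt_toLex, not_lt, le_iff_lt_or_eq]
      simp [hij]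
    rw [heq]
    exact (alternationFree_angularSupport_lt (hpd j i hij.ne') hmono hmem).not
  · refine ⟨(Tuple.sort (θ ∘ e)).symm (e.symm T), fun i hi j hj => ?_⟩
    rw [hρ, Prod.Lex.toLex_lt_toLex]
    left
    have hΘ : Θ ((Tuple.sort (θ ∘ e)).symm (e.symm T)) = θ T := by simp [Θ]
    rw [hΘ, angularSupport_lt_iff]
    exact ⟨T, fun s => ((hb T i).2 hi _ (hqC s i)).trans_lt (hqb T j hj)⟩

/-- A shattered family of `n` nonempty convex sets in the plane has at least
`n(n-3)/6` intersecting pairs. -/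
theorem shattered_convex_sets_many_intersections (n : ℕ) (C : Fin n → Set Plane)
    (hne : ∀ i, (C i).Nonempty)
    (hconv : ∀ i, Convex ℝ (C i))
    (hsh : ShatteredByHalfplanes C) :
    ((n : ℝ) * ((n : ℝ) - 3)) / 6 ≤
      (Set.ncard {p : Fin n × Fin n | p.1 < p.2 ∧ (C p.1 ∩ C p.2).Nonempty} : ℝ) := by
  classical
  let G : SimpleGraph (Fin n) :=
    { Adj := fun i j => i ≠ j ∧ Disjoint (C i) (C j)
      symm := ⟨fun i j h => ⟨h.1.symm, h.2.symm⟩⟩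
      loopless := ⟨fun i h => h.1 rfl⟩ }
  have hG : G.CliqueFree 4 := by
    by_contra hcon
    obtain ⟨f⟩ := SimpleGraph.not_cliqueFree_iff_top_isContained 4 |>.1 hcon
    refine not_shatteredByHalfplanes_of_pairwise_disjoint (C := fun i => C (f i))
      (fun i => hconv _) (fun i j hij => ?_) fun T => ?_
    · have : G.Adj (f i) (f j) := f.toHom.map_adj hij
      exact this.2
    · obtain ⟨h, hh, hT⟩ := hsh (Set.image f T)
      exact ⟨h, hh, fun i => (hT _).trans f.injective.mem_set_image⟩
  have hturan : 3 * G.edgeFinset.card ≤ n ^ 2 := by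
    have h1 := SimpleGraph.CliqueFree.card_edgeFinset_le (r := 3) hG
    have h2 := SimpleGraph.mul_card_edgeFinset_turanGraph_le (n := n) (r := 3)
    rw [SimpleGraph.card_edgeFinset_turanGraph] at h2
    simp only [Fintype.card_fin] at h1
    omega
  let P : Finset (Fin n × Fin n) := Finset.univ.filter fun p => p.1 < p.2
  have hP : P.card * 2 = n * (n - 1) := by
    have hsum : P.card = ∑ j : Fin n, (j : ℕ) := by
      rw [Finset.card_filter, Fintype.sum_prod_type_right]
      refine Finset.sum_congr rfl fun j _ => ?_
      rw [← Finset.card_filter, Finset.filter_gt_eq_Iio, Fin.card_Iio]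
    rw [hsum, Fin.sum_univ_eq_sum_range fun i => i, Finset.sum_range_id_mul_two]
  have hdisj : (P.filter fun p => ¬ (C p.1 ∩ C p.2).Nonempty).card ≤ G.edgeFinset.card := by
    refine Finset.card_le_card_of_injOn (fun p => s(p.1, p.2)) (fun p hp => ?_)
      fun p hp p' hp' h => ?_
    · simp only [P, Finset.coe_filter, Finset.mem_filter, Finset.mem_univ, true_and,
        Set.mem_ofPred_eq, Set.not_nonempty_iff_eq_empty] at hp
      simpa [G, Set.disjoint_iff_inter_eq_empty] using ⟨hp.1.ne, hp.2⟩
    · simp only [P, Finset.coe_filter, Finset.mem_filter, Finset.mem_univ, true_and,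
        Set.mem_ofPred_eq] at hp hp'
      rcases Sym2.eq_iff.1 h with h | h
      · exact Prod.ext h.1 h.2
      · have h1 := hp.1
        rw [h.1, h.2] at h1
        exact absurd h1 hp'.1.not_gt
  have hcount : Set.ncard {p : Fin n × Fin n | p.1 < p.2 ∧ (C p.1 ∩ C p.2).Nonempty} =
      (P.filter fun p => (C p.1 ∩ C p.2).Nonempty).card := by
    rw [← Set.ncard_coe_finset]
    congr 1
    ext p
    simp [P]
  have hsplit := P.card_filter_add_card_filter_not fun p => (C p.1 ∩ C p.2).Nonempty
  rw [hcount]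
  have hP' : (P.card : ℝ) * 2 = n * (n - 1) := by
    rcases n with _ | n
    · simp [P]
    · have := congrArg (Nat.cast : ℕ → ℝ) hP
      push_cast at this
      simpa using this
  have h1 : (3 * G.edgeFinset.card : ℝ) ≤ n ^ 2 := by exact_mod_cast hturan
  have h2 : ((P.filter fun p => ¬ (C p.1 ∩ C p.2).Nonempty).card : ℝ) ≤ G.edgeFinset.card := by
    exact_mod_cast hdisj
  have h3 : ((P.filter fun p => (C p.1 ∩ C p.2).Nonempty).card : ℝ) +
      (P.filter fun p => ¬ (C p.1 ∩ C p.2).Nonempty).card = P.card := by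
    exact_mod_cast hsplit
  nlinarith
end

section
/- Let 𝒞 be a family of nonempty convex sets in the plane ℝ² that is shattered by halfplanes. Then among any four distinct members of 𝒞, some two intersect; equivalently, the intersection graph of 𝒞 has independence number at most 3. -/
open RealInnerProductSpace

/-- The unit vector at angle `θ`. -/
noncomputable def unitVec (θ : ℝ) : Plane := !₂[Real.cos θ, Real.sin θ]

lemma exists_polar {a : Plane} (ha : a ≠ 0) :
    ∃ r : ℝ, 0 < r ∧ ∃ θ : ℝ, -Real.pi < θ ∧ θ ≤ Real.pi ∧ a = r • unitVec θ := by
  let z : ℂ := ⟨a 0, a 1⟩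
  have hz : z ≠ 0 := by
    intro h
    apply ha
    ext i
    fin_cases i
    · exact congrArg Complex.re h
    · exact congrArg Complex.im h
  refine ⟨‖z‖, norm_pos_iff.2 hz, z.arg, Complex.neg_pi_lt_arg z, Complex.arg_le_pi z, ?_⟩
  ext i
  fin_cases i
  · simp [unitVec, Complex.norm_mul_cos_arg, z]
  · simp [unitVec, Complex.norm_mul_sin_arg, z]

lemma unitVec_periodic : Function.Periodic unitVec (2 * Real.pi) := fun θ => by
  simp [unitVec]

lemma sin_smul_unitVec (α β γ : ℝ) :
    Real.sin (γ - α) • unitVec β =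
      Real.sin (γ - β) • unitVec α + Real.sin (β - α) • unitVec γ := by
  ext i
  fin_cases i
  · simp [unitVec, Real.sin_sub]
    ring
  · simp [unitVec, Real.sin_sub]
    ring

section SupportFunction

variable {κ : Type} [Fintype κ] [Nonempty κ]

/-- The support function of a finite family of points. -/
noncomputable def supportFn (x : κ → Plane) (u : Plane) : ℝ :=
  Finset.univ.sup' Finset.univ_nonempty fun t => ⟪u, x t⟫

lemma inner_le_supportFn (x : κ → Plane) (u : Plane) (t : κ) : ⟪u, x t⟫ ≤ supportFn x u :=
  Finset.le_sup' (fun t => ⟪u, x t⟫) (Finset.mem_univ t)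

lemma supportFn_le_iff {x : κ → Plane} {u : Plane} {b : ℝ} :
    supportFn x u ≤ b ↔ ∀ t, ⟪u, x t⟫ ≤ b := by
  simp [supportFn]

lemma supportFn_lt_iff {x : κ → Plane} {u : Plane} {b : ℝ} :
    supportFn x u < b ↔ ∀ t, ⟪u, x t⟫ < b := by
  simp [supportFn]

lemma supportFn_comb_le (x : κ → Plane) (u v : Plane) {r s : ℝ} (hr : 0 ≤ r) (hs : 0 ≤ s) :
    supportFn x (r • u + s • v) ≤ r * supportFn x u + s * supportFn x v := by
  refine supportFn_le_iff.2 fun t => ?_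
  rw [inner_add_left, real_inner_smul_left, real_inner_smul_left]
  gcongr <;> exact inner_le_supportFn x _ t

lemma le_supportFn_comb (x : κ → Plane) (u v : Plane) (r : ℝ) {s : ℝ} (hs : 0 ≤ s) :
    r * supportFn x u ≤ supportFn x (r • u + s • v) + s * supportFn x (-v) := by
  obtain ⟨t, -, ht⟩ := Finset.exists_mem_eq_sup' Finset.univ_nonempty fun t => ⟪u, x t⟫
  have h1 := inner_le_supportFn x (r • u + s • v) t
  have h2 := mul_le_mul_of_nonneg_left (inner_le_supportFn x (-v) t) hs
  rw [inner_add_left, real_inner_smul_left, real_inner_smul_left] at h1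
  rw [inner_neg_left] at h2
  have h3 : supportFn x u = ⟪u, x t⟫ := ht
  rw [h3]
  linarith

lemma exists_supportFn_add_neg {x y : κ → Plane}
    (h : Disjoint (convexHull ℝ (Set.range x)) (convexHull ℝ (Set.range y))) :
    ∃ φ : ℝ, supportFn x (unitVec φ) + supportFn y (-unitVec φ) < 0 := by
  obtain ⟨l, a, b, hl, hab, hr⟩ := geometric_hahn_banach_compact_closed
    (convex_convexHull ℝ _) ((Set.finite_range x).isCompact_convexHull ℝ)
    (convex_convexHull ℝ _) ((Set.finite_range y).isClosed_convexHull ℝ) h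
  set v : Plane := (InnerProductSpace.toDual ℝ Plane).symm l with hv
  have hin : ∀ p, ⟪v, p⟫ = l p := fun p => InnerProductSpace.toDual_symm_apply
  have hx : ∀ t, ⟪v, x t⟫ < a := fun t => by
    rw [hin]; exact hl _ (subset_convexHull ℝ _ ⟨t, rfl⟩)
  have hy : ∀ t, b < ⟪v, y t⟫ := fun t => by
    rw [hin]; exact hr _ (subset_convexHull ℝ _ ⟨t, rfl⟩)
  have hv0 : v ≠ 0 := by
    intro h0
    obtain ⟨t⟩ := ‹Nonempty κ›
    have h1 := hx t
    have h2 := hy t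
    rw [h0, inner_zero_left] at h1 h2
    linarith
  obtain ⟨r, hr0, φ, -, -, hφ⟩ := exists_polar hv0
  refine ⟨φ, ?_⟩
  have h1 : supportFn x (unitVec φ) < a / r := by
    refine supportFn_lt_iff.2 fun t => ?_
    have := hx t
    rw [hφ, real_inner_smul_left] at this
    rw [lt_div_iff₀ hr0]
    linarith
  have h2 : supportFn y (-unitVec φ) < -(b / r) := by
    refine supportFn_lt_iff.2 fun t => ?_
    have := hy t
    rw [hφ, real_inner_smul_left] at this
    rw [inner_neg_left, neg_lt_neg_iff, div_lt_iff₀ hr0]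
    linarith
  have h3 : a / r < b / r := by gcongr
  linarith

/-- Comparison of two support functions in direction `u`, ties being decided by `Q`. -/
def SupportLT (x y : κ → Plane) (Q : Prop) (u : Plane) : Prop :=
  supportFn x u < supportFn y u ∨ supportFn x u = supportFn y u ∧ Q

lemma SupportLT.comb {x y : κ → Plane} {Q : Prop} {u v : Plane}
    (h : SupportLT x y Q u) (hv : supportFn x v + supportFn y (-v) < 0)
    {r s : ℝ} (hr : 0 ≤ r) (hs : 0 ≤ s) (hrs : 0 < r ∨ 0 < s) :
    SupportLT x y Q (r • u + s • v) := by
  have h1 := supportFn_comb_le x u v hr hs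
  have h2 := le_supportFn_comb y u v r hs
  rcases h with h | ⟨h, hQ⟩
  · left
    rcases hrs with hr | hs <;> nlinarith
  · rw [h] at h1
    have h3 : supportFn x (r • u + s • v) ≤ supportFn y (r • u + s • v) := by nlinarith
    rcases h3.lt_or_eq with h3 | h3
    · exact Or.inl h3
    · exact Or.inr ⟨h3, hQ⟩

lemma SupportLT.of_smul {x y : κ → Plane} {Q : Prop} {u v : Plane} {r : ℝ} (hr : 0 < r)
    (hv : supportFn x v + supportFn y (-v) < 0)
    (h : SupportLT x y Q (r • u)) : SupportLT x y Q u := by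
  have := h.comb hv (inv_nonneg.2 hr.le) le_rfl (Or.inl (inv_pos.2 hr))
  simpa [smul_smul, hr.ne'] using this

lemma SupportLT.not_neg {x y : κ → Plane} {Q : Prop} {v : Plane}
    (hv : supportFn x v + supportFn y (-v) < 0) : ¬ SupportLT x y Q (-v) := by
  have h := supportFn_comb_le x v (-v) zero_le_one zero_le_one
  have h0 : supportFn x ((1 : ℝ) • v + (1 : ℝ) • -v) = 0 := by simp [supportFn]
  rintro (h1 | ⟨h1, -⟩) <;> linarith

lemma unitVec_add_pi (θ : ℝ) : unitVec (θ + Real.pi) = -unitVec θ := by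
  ext i
  fin_cases i <;> simp [unitVec]

lemma unitVec_sub_pi (θ : ℝ) : unitVec (θ - Real.pi) = -unitVec θ := by
  ext i
  fin_cases i <;> simp [unitVec]

lemma SupportLT.of_le_of_le {x y : κ → Plane} {Q : Prop} {φ α β : ℝ}
    (hφ : supportFn x (unitVec φ) + supportFn y (-unitVec φ) < 0)
    (hα : SupportLT x y Q (unitVec α)) (hαφ : φ - Real.pi ≤ α) (hαβ : α ≤ β) (hβ : β ≤ φ) :
    SupportLT x y Q (unitVec β) := by
  rcases hαβ.eq_or_lt with rfl | hαβ
  · exact hα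
  rcases hαφ.eq_or_lt with rfl | hαφ
  · rw [unitVec_sub_pi] at hα
    exact absurd hα (not_neg hφ)
  refine of_smul (r := Real.sin (φ - α)) (Real.sin_pos_of_pos_of_lt_pi ?_ ?_) hφ ?_
  · linarith
  · linarith
  rw [sin_smul_unitVec]
  exact hα.comb hφ (Real.sin_nonneg_of_nonneg_of_le_pi (by linarith) (by linarith))
    (Real.sin_nonneg_of_nonneg_of_le_pi (by linarith) (by linarith))
    (Or.inr (Real.sin_pos_of_pos_of_lt_pi (by linarith) (by linarith)))

lemma SupportLT.of_ge_of_ge {x y : κ → Plane} {Q : Prop} {φ α β : ℝ}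
    (hφ : supportFn x (unitVec φ) + supportFn y (-unitVec φ) < 0)
    (hα : SupportLT x y Q (unitVec α)) (hαφ : α ≤ φ + Real.pi) (hαβ : β ≤ α) (hβ : φ ≤ β) :
    SupportLT x y Q (unitVec β) := by
  rcases hαβ.eq_or_lt with rfl | hαβ
  · exact hα
  rcases hαφ.eq_or_lt with rfl | hαφ
  · rw [unitVec_add_pi] at hα
    exact absurd hα (not_neg hφ)
  refine of_smul (r := Real.sin (α - φ)) (Real.sin_pos_of_pos_of_lt_pi ?_ ?_) hφ ?_
  · linarith
  · linarith
  rw [sin_smul_unitVec, add_comm]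
  exact hα.comb hφ (Real.sin_nonneg_of_nonneg_of_le_pi (by linarith) (by linarith))
    (Real.sin_nonneg_of_nonneg_of_le_pi (by linarith) (by linarith))
    (Or.inr (Real.sin_pos_of_pos_of_lt_pi (by linarith) (by linarith)))

/-- On the circle of directions, the support functions of two separated families of points
compare in at most two arcs. -/
lemma SupportLT.not_alternating {x y : κ → Plane} {Q : Prop} {φ α β γ δ : ℝ}
    (hφ : supportFn x (unitVec φ) + supportFn y (-unitVec φ) < 0)
    (hαβ : α ≤ β) (hβγ : β ≤ γ) (hγδ : γ ≤ δ) (hδα : δ ≤ α + 2 * Real.pi)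
    (hα : SupportLT x y Q (unitVec α)) (hβ : ¬ SupportLT x y Q (unitVec β))
    (hγ : SupportLT x y Q (unitVec γ)) : SupportLT x y Q (unitVec δ) := by
  have hpi := Real.two_pi_pos
  obtain ⟨ψ, ⟨h1, h2⟩, hψ⟩ : ∃ ψ ∈ Set.Ico (α - Real.pi) (α - Real.pi + 2 * Real.pi),
      unitVec φ = unitVec ψ := unitVec_periodic.exists_mem_Ico hpi φ _
  rw [hψ] at hφ
  have key : ∀ {ψ a b c : ℝ}, supportFn x (unitVec ψ) + supportFn y (-unitVec ψ) < 0 →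
      SupportLT x y Q (unitVec a) → SupportLT x y Q (unitVec c) →
      ψ - Real.pi ≤ a → a ≤ b → b ≤ c → c ≤ ψ + Real.pi → SupportLT x y Q (unitVec b) := by
    intro ψ a b c hψ ha hc h1 h2 h3 h4
    rcases le_total b ψ with hb | hb
    · exact of_le_of_le hψ ha h1 h2 hb
    · exact of_ge_of_ge hψ hc h4 h3 hb
  rcases le_total γ (ψ + Real.pi) with h | h
  · exact absurd (key hφ hα hγ (by linarith) hαβ hβγ h) hβ
  · rw [← unitVec_periodic ψ] at hφ
    rw [← unitVec_periodic α] at hα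
    exact key hφ hγ hα (by linarith) hγδ hδα (by linarith)

end SupportFunction

lemma card_cyclic_descents_le_one {m : ℕ} {P : ℝ → Prop} {θ : Fin (m + 1) → ℝ} {L : ℝ}
    (hP : ∀ α β γ δ : ℝ, α ≤ β → β ≤ γ → γ ≤ δ → δ ≤ α + L → P α → ¬ P β → P γ → P δ)
    (hP' : ∀ α β γ δ : ℝ, α ≤ β → β ≤ γ → γ ≤ δ → δ ≤ α + L → ¬ P α → P β → ¬ P γ → ¬ P δ)
    (hθ : Monotone θ) (hL : ∀ k l, θ k ≤ θ l + L) [DecidablePred P] :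
    (Finset.univ.filter fun k => P (θ k) ∧ ¬ P (θ (k + 1))).card ≤ 1 := by
  rw [Finset.card_le_one]
  intro k hk l hl
  simp only [Finset.mem_filter, Finset.mem_univ, true_and] at hk hl
  by_contra hne
  wlog hkl : k < l generalizing k l
  · exact this l k hl hk (Ne.symm hne) (lt_of_le_of_ne (not_lt.1 hkl) (Ne.symm hne))
  have hk1 : k ≤ k + 1 ∧ k + 1 ≤ l := by
    have : ((k + 1 : Fin (m + 1)) : ℕ) = k + 1 :=
      Fin.val_add_one_of_lt (lt_of_lt_of_le hkl (Fin.le_last l))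
    simp only [Fin.le_def, Fin.lt_def] at *
    omega
  rcases (Fin.le_last l).eq_or_lt with h | h
  · have hl0 : l + 1 = 0 := by rw [h, Fin.last_add_one]
    rw [hl0] at hl
    exact hP' _ _ _ _ (hθ (Fin.zero_le k)) (hθ hk1.1) (hθ hk1.2) (hL _ _) hl.2 hk.1 hk.2 hl.1
  · have : l ≤ l + 1 := by
      have := Fin.val_add_one_of_lt h
      rw [Fin.le_def, this]
      exact Nat.le_succ _
    exact hl.2 (hP _ _ _ _ (hθ hk1.1) (hθ hk1.2) (hθ this) (hL _ _) hk.1 hk.2 hl.1)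

open scoped Fin.CommRing Fin.NatCast in
lemma card_le_card_cyclic_changes {m : ℕ} {α : Type} [DecidableEq α] (f : Fin (m + 1) → α)
    {V : Finset α} (hV : ∀ v ∈ V, ∃ k, f k = v) (hV2 : 1 < V.card) :
    V.card ≤ (Finset.univ.filter fun k => f k ≠ f (k + 1)).card := by
  refine (Finset.card_le_card fun v hv => ?_).trans (Finset.card_image_le (f := f))
  by_contra hcon
  simp only [Finset.mem_image, Finset.mem_filter, Finset.mem_univ, true_and, not_exists,
    not_and] at hcon
  obtain ⟨k₀, hk₀⟩ := hV v hv
  have hstep : ∀ n : ℕ, f (k₀ + (Nat.cast n : Fin (m + 1))) = v := by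
    intro n
    induction n with
    | zero => simpa using hk₀
    | succ n ih =>
      by_contra hne
      refine hcon _ (fun h => hne ?_) ih
      rw [Nat.cast_succ, ← add_assoc, ← h, ih]
  obtain ⟨w, hw, hwv⟩ := Finset.exists_mem_ne hV2 v
  obtain ⟨l, hl⟩ := hV w hw
  apply hwv
  have := hstep (l - k₀ : Fin (m + 1)).val
  rw [Fin.cast_val_eq_self, add_sub_cancel, hl] at this
  exact this

/-- The `m + 1` elements of smallest rank. -/
def initialSeg (σ : Equiv.Perm (Fin 4)) (m : Fin 3) : Finset (Fin 4) :=
  Finset.univ.filter fun i => (σ i : ℕ) < m + 1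

/-- The ordered pairs whose order is reversed between two rankings. -/
def inversionPairs (σ τ : Equiv.Perm (Fin 4)) : Finset (Fin 4 × Fin 4) :=
  Finset.univ.filter fun p => σ p.1 < σ p.2 ∧ ¬ τ p.1 < τ p.2

lemma card_initialSeg_ne_le (σ τ : Equiv.Perm (Fin 4)) :
    (Finset.univ.filter fun m => initialSeg σ m ≠ initialSeg τ m).card ≤
      (inversionPairs σ τ).card := by
  revert σ τ
  decide +kernel

lemma card_initialSeg (σ : Equiv.Perm (Fin 4)) (m : Fin 3) :
    (initialSeg σ m).card = m + 1 := by
  revert σ m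
  decide +kernel

/-- Any family shattered by halfplanes contains finite families of points, indexed by the
subfamilies, whose support functions realize every subfamily in some direction. -/
lemma ShatteredByHalfplanes.exists_points {ι : Type} {C : ι → Set Plane}
    (hne : ∀ i, (C i).Nonempty) (hsh : ShatteredByHalfplanes C) (e : Fin 4 → ι)
    (he : Function.Injective e) :
    ∃ x : Fin 4 → Finset (Fin 4) → Plane, (∀ i T, x i T ∈ C (e i)) ∧
      ∀ T : Finset (Fin 4), ∃ θ : ℝ, -Real.pi < θ ∧ θ ≤ Real.pi ∧ ∀ i ∈ T, ∀ j ∉ T,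
        supportFn (x i) (unitVec θ) < supportFn (x j) (unitVec θ) := by
  have h : ∀ T : Finset (Fin 4), ∃ (y : Fin 4 → Plane) (θ b : ℝ), -Real.pi < θ ∧ θ ≤ Real.pi ∧
      (∀ i, y i ∈ C (e i)) ∧ (∀ i ∈ T, ∀ p ∈ C (e i), ⟪unitVec θ, p⟫ ≤ b) ∧
      ∀ j ∉ T, b < ⟪unitVec θ, y j⟫ := by
    intro T
    obtain ⟨_, ⟨a, ha, b, rfl⟩, hT⟩ := hsh (e '' T)
    obtain ⟨r, hr, θ, h1, h2, rfl⟩ := exists_polar ha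
    have hT' : ∀ i, (∀ p ∈ C (e i), ⟪unitVec θ, p⟫ ≤ b / r) ↔ i ∈ T := by
      intro i
      rw [← Finset.mem_coe, ← he.mem_set_image, ← hT]
      refine forall₂_congr fun p _ => ?_
      rw [le_div_iff₀ hr, mul_comm, Set.mem_ofPred_eq, real_inner_smul_left]
    have hy : ∀ i, ∃ p ∈ C (e i), i ∉ T → b / r < ⟪unitVec θ, p⟫ := by
      intro i
      by_cases hi : i ∈ T
      · obtain ⟨p, hp⟩ := hne (e i)
        exact ⟨p, hp, fun h => absurd hi h⟩
      · rw [← hT'] at hi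
        push Not at hi
        obtain ⟨p, hp, h⟩ := hi
        exact ⟨p, hp, fun _ => h⟩
    choose y hy hyT using hy
    exact ⟨y, θ, b / r, h1, h2, hy, fun i hi => (hT' i).2 hi, hyT⟩
  choose y θ b h1 h2 hy hT hnT using h
  refine ⟨fun i T => y T i, fun i T => hy T i, fun T => ⟨θ T, h1 T, h2 T, fun i hi j hj => ?_⟩⟩
  exact (supportFn_le_iff.2 fun S => hT T i hi _ (hy S i)).trans_lt
    ((hnT T j hj).trans_le (inner_le_supportFn (fun S => y S j) _ T))

/-- The directions in which all subfamilies of four families of points are realized have to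
reverse some pair more often than separated families allow. -/
lemma exists_not_disjoint_convexHull (x : Fin 4 → Finset (Fin 4) → Plane)
    (hx : ∀ T : Finset (Fin 4), ∃ θ : ℝ, -Real.pi < θ ∧ θ ≤ Real.pi ∧ ∀ i ∈ T, ∀ j ∉ T,
      supportFn (x i) (unitVec θ) < supportFn (x j) (unitVec θ)) :
    ∃ i j, i ≠ j ∧
      ¬ Disjoint (convexHull ℝ (Set.range (x i))) (convexHull ℝ (Set.range (x j))) := by
  classical
  by_contra! hdisj
  choose θ₀ hlow hupp hreal using hx
  let e₀ : Fin 16 ≃ Finset (Fin 4) := (Fintype.equivFinOfCardEq (by simp)).symm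
  let e : Fin 16 ≃ Finset (Fin 4) := (Tuple.sort (θ₀ ∘ e₀)).trans e₀
  let θ : Fin 16 → ℝ := θ₀ ∘ e
  have hθ : Monotone θ := Tuple.monotone_sort (θ₀ ∘ e₀)
  have hθL : ∀ k l, θ k ≤ θ l + 2 * Real.pi := fun k l => by
    have h1 : θ k ≤ Real.pi := hupp (e k)
    have h2 : -Real.pi < θ l := hlow (e l)
    linarith
  let key : ℝ → Fin 4 → ℝ ×ₗ Fin 4 := fun t i => toLex (supportFn (x i) (unitVec t), i)
  have hkey : ∀ t i j, key t i < key t j ↔ SupportLT (x i) (x j) (i < j) (unitVec t) :=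
    fun t i j => Prod.Lex.toLex_lt_toLex
  have hinj : ∀ t, Function.Injective (key t) := fun t i j h =>
    congrArg (fun p => (ofLex p).2) h
  let σ : Fin 16 → Equiv.Perm (Fin 4) := fun k => (Tuple.sort (key (θ k))).symm
  have hσ : ∀ k i j, σ k i < σ k j ↔ key (θ k) i < key (θ k) j := by
    intro k i j
    have hmono : StrictMono (key (θ k) ∘ Tuple.sort (key (θ k))) :=
      (Tuple.monotone_sort _).strictMono_of_injective
        ((hinj _).comp (Tuple.sort (key (θ k))).injective)
    rw [← hmono.lt_iff_lt]
    simp [σ]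
  have hdesc : ∀ i j, (Finset.univ.filter fun k =>
      σ k i < σ k j ∧ ¬ σ (k + 1) i < σ (k + 1) j).card ≤ if i = j then 0 else 1 := by
    intro i j
    split_ifs with hij
    · simp [hij]
    obtain ⟨φ, hφ⟩ := exists_supportFn_add_neg (hdisj i j hij)
    obtain ⟨ψ, hψ⟩ := exists_supportFn_add_neg (hdisj j i (Ne.symm hij))
    have hnot : ∀ t, ¬ key t i < key t j ↔ key t j < key t i := fun t =>
      not_lt.trans ⟨fun h => h.lt_of_ne ((hinj t).ne (Ne.symm hij)), le_of_lt⟩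
    simp only [hσ]
    refine card_cyclic_descents_le_one (P := fun t => key t i < key t j) (L := 2 * Real.pi)
      ?_ ?_ hθ hθL
    · intro α β γ δ h1 h2 h3 h4 hα hβ hγ
      rw [hkey] at *
      exact hα.not_alternating hφ h1 h2 h3 h4 hβ hγ
    · intro α β γ δ h1 h2 h3 h4 hα hβ hγ
      rw [← not_not (a := key β i < key β j)] at hβ
      rw [hnot, hkey] at *
      exact hα.not_alternating hψ h1 h2 h3 h4 hβ hγ
  have hseg : ∀ k (m : Fin 3), (e k).card = m + 1 → initialSeg (σ k) m = e k := by
    intro k m hk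
    have hlt : ∀ i ∈ e k, ∀ j ∉ e k, σ k i < σ k j := fun i hi j hj =>
      (hσ k i j).2 ((hkey _ _ _).2 (Or.inl (hreal (e k) i hi j hj)))
    have hcard : (initialSeg (σ k) m).card = (e k).card := (card_initialSeg _ _).trans hk.symm
    by_contra hne
    obtain ⟨i, hi, hi'⟩ := Finset.not_subset.1 fun h => hne
      (Finset.eq_of_subset_of_card_le h hcard.ge)
    obtain ⟨j, hj, hj'⟩ := Finset.not_subset.1 fun h => hne
      (Finset.eq_of_subset_of_card_le h hcard.le).symm
    have := hlt j hj i hi'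
    simp only [initialSeg, Finset.mem_filter, Finset.mem_univ, true_and] at hi hj'
    rw [Fin.lt_def] at this
    omega
  have hchanges : ∀ m : Fin 3, Nat.choose 4 (m + 1) ≤ (Finset.univ.filter fun k =>
      initialSeg (σ k) m ≠ initialSeg (σ (k + 1)) m).card := by
    intro m
    have hV : (Finset.powersetCard (m + 1) (Finset.univ : Finset (Fin 4))).card =
        Nat.choose 4 (m + 1) := by simp
    rw [← hV]
    refine card_le_card_cyclic_changes (fun k => initialSeg (σ k) m) (fun T hT => ?_) ?_
    · refine ⟨e.symm T, ?_⟩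
      have := hseg (e.symm T) m
      simpa [(Finset.mem_powersetCard.1 hT).2] using this
    · rw [hV]
      fin_cases m <;> decide
  have hupper : ∑ k, (inversionPairs (σ k) (σ (k + 1))).card ≤ 12 := by
    calc _ = ∑ p : Fin 4 × Fin 4, (Finset.univ.filter fun k =>
            σ k p.1 < σ k p.2 ∧ ¬ σ (k + 1) p.1 < σ (k + 1) p.2).card :=
          Finset.sum_card_bipartiteAbove_eq_sum_card_bipartiteBelow _
      _ ≤ ∑ p : Fin 4 × Fin 4, if p.1 = p.2 then 0 else 1 :=
          Finset.sum_le_sum fun p _ => hdesc p.1 p.2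
      _ = 12 := by decide
  have hlower : 14 ≤ ∑ k, (Finset.univ.filter fun m =>
      initialSeg (σ k) m ≠ initialSeg (σ (k + 1)) m).card := by
    calc 14 = ∑ m : Fin 3, Nat.choose 4 (m + 1) := by decide
      _ ≤ _ := Finset.sum_le_sum fun m _ => hchanges m
      _ = _ := (Finset.sum_card_bipartiteAbove_eq_sum_card_bipartiteBelow _).symm
  have := Finset.sum_le_sum fun k (_ : k ∈ Finset.univ) =>
    card_initialSeg_ne_le (σ k) (σ (k + 1))
  omega

/-- In a shattered family of nonempty convex sets in the plane, among any four distinct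
members some two intersect. -/
theorem shattered_convex_sets_no_four_pairwise_disjoint
    (n : ℕ) (C : Fin n → Set Plane)
    (hne : ∀ i, (C i).Nonempty)
    (hconv : ∀ i, Convex ℝ (C i))
    (hsh : ShatteredByHalfplanes C)
    (a b c d : Fin n)
    (hab : a ≠ b) (hac : a ≠ c) (had : a ≠ d)
    (hbc : b ≠ c) (hbd : b ≠ d) (hcd : c ≠ d) :
    ∃ p q : Fin n, p ∈ ({a, b, c, d} : Set (Fin n)) ∧ q ∈ ({a, b, c, d} : Set (Fin n)) ∧
      p ≠ q ∧ (C p ∩ C q).Nonempty := by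
  let e : Fin 4 → Fin n := ![a, b, c, d]
  have he : Function.Injective e := by
    intro i j
    fin_cases i <;> fin_cases j <;> simp_all [e, eq_comm]
  have hmem : ∀ i, e i ∈ ({a, b, c, d} : Set (Fin n)) := by
    intro i
    fin_cases i <;> simp [e]
  obtain ⟨x, hx, hreal⟩ := ShatteredByHalfplanes.exists_points hne hsh e he
  obtain ⟨i, j, hij, hdisj⟩ := exists_not_disjoint_convexHull x hreal
  have hsub : ∀ i, convexHull ℝ (Set.range (x i)) ⊆ C (e i) := fun i =>
    convexHull_min (Set.range_subset_iff.2 (hx i)) (hconv _)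
  exact ⟨e i, e j, hmem i, hmem j, he.ne hij,
    (Set.not_disjoint_iff_nonempty_inter.1 hdisj).mono (Set.inter_subset_inter (hsub i) (hsub j))⟩
end
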